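/- Asymptotics of the conditional mutual information of the output noise (Lemma relation_MIs). Define I_n(ξ^*; D | θ^*) := − E log E_ξ P_out(Y_1 | ρ a^{*⊤}X_1^{(L)}/√d_L + √ε ξ) + E E_{ξ^*} log P_out(Y_1 | ρ a^{*⊤}X_1^{(L)}/√d_L + √ε ξ^*), where ξ, ξ^* ~ N(0,1) are independent of everything else and Y_1 is drawn from P_out(·| ρ a^{*⊤}X_1^{(L)}/√d_L + √ε ξ_1^*). Then I_n(ξ^*;D|θ^*) = − ∫ dy E_{Z,ξ^*}[ P_out(y|Z√(ρ²σ_L)+√ε ξ^*) · log E_ξ P_out(y|Z√(ρ²σ_L)+√ε ξ) ] + ∫ dy E_Z[ P_out(y|Z√(ρ²σ_L+ε)) log P_out(y|Z√(ρ²σ_L+ε)) ] + O(d_m^{−1/2}), where Z ~ N(0,1). -/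

import Mathlib

open MeasureTheory ProbabilityTheory

noncomputable section

/-- Standard Gaussian measure on `ℝ`. -/
def stdG : Measure ℝ := gaussianReal 0 1

instance : IsProbabilityMeasure stdG := by unfold stdG; infer_instance

/-- Standard Gaussian measure on `Fin k → ℝ`. -/
def stdGPi (k : ℕ) : Measure (Fin k → ℝ) := Measure.pi fun _ => stdG

instance (k : ℕ) : IsProbabilityMeasure (stdGPi k) := by unfold stdGPi; infer_instance

/-- The space of weights of an `L`-hidden-layer network with widths `d 0, …, d L`. -/
abbrev Wspace (d : ℕ → ℕ) (L : ℕ) :=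
  (ℓ : Fin L) → Fin (d ((ℓ : ℕ) + 1)) → Fin (d (ℓ : ℕ)) → ℝ

/-- i.i.d. standard Gaussian measure on the weights. -/
def Wmeasure (d : ℕ → ℕ) (L : ℕ) : Measure (Wspace d L) :=
  Measure.pi fun ℓ => Measure.pi fun _ => stdGPi (d (ℓ : ℕ))

instance (d : ℕ → ℕ) (L : ℕ) : IsProbabilityMeasure (Wmeasure d L) := by
  unfold Wmeasure; infer_instance

/-- Extension of a finite collection of weight matrices to all layer indices (by zero). -/
def extW {d : ℕ → ℕ} {L : ℕ} (W : Wspace d L) (ℓ : ℕ) : Fin (d (ℓ + 1)) → Fin (d ℓ) → ℝ :=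
  if h : ℓ < L then W ⟨ℓ, h⟩ else 0

/-- Post-activations `X^{(ℓ)} = φ(W^{(ℓ)} X^{(ℓ-1)} / √d_{ℓ-1})`. -/
def feat (φ : ℝ → ℝ) (d : ℕ → ℕ) (W : (ℓ : ℕ) → Fin (d (ℓ + 1)) → Fin (d ℓ) → ℝ)
    (x0 : Fin (d 0) → ℝ) : (ℓ : ℕ) → Fin (d ℓ) → ℝ
  | 0 => x0
  | (ℓ + 1) => fun i => φ ((∑ j, W ℓ i j * feat φ d W x0 ℓ j) / Real.sqrt (d ℓ : ℝ))

/-- Output kernel `P_out(y | x)`. -/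
def Pout {p : ℕ} (PA : Measure (Fin p → ℝ)) (Δ : ℝ) (f : ℝ → (Fin p → ℝ) → ℝ)
    (y x : ℝ) : ℝ :=
  ∫ A, Real.exp (-(y - f x A) ^ 2 / (2 * Δ)) / Real.sqrt (2 * Real.pi * Δ) ∂PA

/-- The channel smeared with the extra Gaussian noise `√ε ξ`. -/
def PoutEps {p : ℕ} (PA : Measure (Fin p → ℝ)) (Δ : ℝ) (f : ℝ → (Fin p → ℝ) → ℝ)
    (ε y s : ℝ) : ℝ :=
  ∫ ξ, Pout PA Δ f y (s + Real.sqrt ε * ξ) ∂stdG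

/-- The coefficients `σ_ℓ`. -/
def sigmaC (φ : ℝ → ℝ) : ℕ → ℝ
  | 0 => 1
  | (ℓ + 1) => ∫ z, (φ (z * Real.sqrt (sigmaC φ ℓ))) ^ 2 ∂stdG

/-- The coefficients `ρ_ℓ` (meaningful for `ℓ ≥ 1`). -/
def rhoC (φ : ℝ → ℝ) (ℓ : ℕ) : ℝ :=
  ∫ z, deriv φ (z * Real.sqrt (sigmaC φ (ℓ - 1))) ∂stdG

/-- The coefficients `ε_ℓ = σ_ℓ - σ_{ℓ-1} ρ_ℓ²` (meaningful for `ℓ ≥ 1`). -/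
def epsC (φ : ℝ → ℝ) (ℓ : ℕ) : ℝ :=
  sigmaC φ ℓ - sigmaC φ (ℓ - 1) * (rhoC φ ℓ) ^ 2

/-- `d_m = min{d_0, …, d_L}`. -/
def dmin (d : ℕ → ℕ) (L : ℕ) : ℕ :=
  (Finset.range (L + 1)).inf' (Finset.nonempty_range_iff.mpr (Nat.succ_ne_zero L)) d

/-- Linear readout of the `L`-layer network: `a⊤ X^{(L)} / √d_L`. -/
def netOut (φ : ℝ → ℝ) (d : ℕ → ℕ) (L : ℕ) (W : Wspace d L) (a : Fin (d L) → ℝ)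
    (x0 : Fin (d 0) → ℝ) : ℝ :=
  (∑ i, a i * feat φ d (extW W) x0 L i) / Real.sqrt (d L : ℝ)

/-- Partition function (normalisation of the Bayes posterior) of the `L`-layer model. -/
def partFun (L p : ℕ) (PA : Measure (Fin p → ℝ)) [IsProbabilityMeasure PA]
    (Δ ρ ε : ℝ) (φ : ℝ → ℝ) (f : ℝ → (Fin p → ℝ) → ℝ) (d : ℕ → ℕ) (n : ℕ)
    (X : Fin n → Fin (d 0) → ℝ) (Y : Fin n → ℝ) : ℝ :=
  ∫ θ : Wspace d L × (Fin (d L) → ℝ),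
      ∏ μ, PoutEps PA Δ f ε (Y μ) (ρ * netOut φ d L θ.1 θ.2 (X μ))
    ∂((Wmeasure d L).prod (stdGPi (d L)))

/-- Space of all the quenched randomness of the `L`-layer teacher model:
inputs, teacher weights, readout, output noises `ξ*`, label noises `Z` and channel
randomness `A`. -/
abbrev Dspace (d : ℕ → ℕ) (L p n : ℕ) :=
  (Fin n → Fin (d 0) → ℝ) × Wspace d L × (Fin (d L) → ℝ) ×
    (Fin n → ℝ) × (Fin n → ℝ) × (Fin n → Fin p → ℝ)

/-- Law of the quenched randomness. -/
def Dmeasure (d : ℕ → ℕ) (L p n : ℕ) (PA : Measure (Fin p → ℝ))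
    [IsProbabilityMeasure PA] : Measure (Dspace d L p n) :=
  (Measure.pi fun _ : Fin n => stdGPi (d 0)).prod
    ((Wmeasure d L).prod ((stdGPi (d L)).prod
      ((stdGPi n).prod ((stdGPi n).prod (Measure.pi fun _ : Fin n => PA)))))

/-- Teacher pre-readout signal `S_μ = ρ a*⊤X_μ^{(L)}/√d_L + √ε ξ*_μ`. -/
def Ssig (φ : ℝ → ℝ) (d : ℕ → ℕ) (L p n : ℕ) (ρ ε : ℝ) (ω : Dspace d L p n)
    (μi : Fin n) : ℝ :=
  ρ * netOut φ d L ω.2.1 ω.2.2.1 (ω.1 μi) + Real.sqrt ε * ω.2.2.2.1 μi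

/-- Teacher responses `Y_μ = f(S_μ; A_μ) + √Δ Z_μ`. -/
def Yresp (φ : ℝ → ℝ) (f : ℝ → (Fin p → ℝ) → ℝ) (d : ℕ → ℕ) (L n : ℕ)
    (ρ ε Δ : ℝ) (ω : Dspace d L p n) (μi : Fin n) : ℝ :=
  f (Ssig φ d L p n ρ ε ω μi) (ω.2.2.2.2.2 μi) + Real.sqrt Δ * ω.2.2.2.2.1 μi

/-- Mutual information per sample
`(1/n) I_n = E log P_out(Y_1|S_1) - (1/n) E log Z_L(D_L)`
(the first term is written as an average over samples, all equal by symmetry). -/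
def MIper (L p : ℕ) (PA : Measure (Fin p → ℝ)) [IsProbabilityMeasure PA]
    (Δ ρ ε : ℝ) (φ : ℝ → ℝ) (f : ℝ → (Fin p → ℝ) → ℝ) (d : ℕ → ℕ) (n : ℕ) : ℝ :=
  (1 / (n : ℝ)) * ∑ μi : Fin n,
      ∫ ω, Real.log (Pout PA Δ f (Yresp φ f d L n ρ ε Δ ω μi) (Ssig φ d L p n ρ ε ω μi))
        ∂(Dmeasure d L p n PA)
    - (1 / (n : ℝ)) *
      ∫ ω, Real.log (partFun L p PA Δ ρ ε φ f d n ω.1 (Yresp φ f d L n ρ ε Δ ω))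
        ∂(Dmeasure d L p n PA)


/-- Single-sample quenched randomness `(X^{(0)}, W*, a*, ξ*, A, Z)`. -/
abbrev oneSpace (d : ℕ → ℕ) (L p : ℕ) :=
  (Fin (d 0) → ℝ) × Wspace d L × (Fin (d L) → ℝ) × ℝ × (Fin p → ℝ) × ℝ

def oneMeasure (d : ℕ → ℕ) (L p : ℕ) (PA : Measure (Fin p → ℝ))
    [IsProbabilityMeasure PA] : Measure (oneSpace d L p) :=
  (stdGPi (d 0)).prod ((Wmeasure d L).prod ((stdGPi (d L)).prod
    (stdG.prod (PA.prod stdG))))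

/-- Teacher signal `S₁ = ρ a*⊤X₁^{(L)}/√d_L + √ε ξ₁*` for the single sample. -/
def oneSig (φ : ℝ → ℝ) (d : ℕ → ℕ) (L p : ℕ) (ρ ε : ℝ) (ω : oneSpace d L p) : ℝ :=
  ρ * netOut φ d L ω.2.1 ω.2.2.1 ω.1 + Real.sqrt ε * ω.2.2.2.1

/-- Response `Y₁ = f(S₁;A) + √Δ Z`. -/
def oneY (φ : ℝ → ℝ) (f : ℝ → (Fin p → ℝ) → ℝ) (d : ℕ → ℕ) (L : ℕ) (ρ ε Δ : ℝ)
    (ω : oneSpace d L p) : ℝ :=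
  f (oneSig φ d L p ρ ε ω) ω.2.2.2.2.1 + Real.sqrt Δ * ω.2.2.2.2.2

/-- The conditional mutual information
`I_n(ξ*; D | θ*) = −E log E_ξ P_out(Y₁ | ρ a*⊤X₁^{(L)}/√d_L + √ε ξ)
 + E E_{ξ*} log P_out(Y₁ | ρ a*⊤X₁^{(L)}/√d_L + √ε ξ*)`. -/
def condMI (L p : ℕ) (PA : Measure (Fin p → ℝ)) [IsProbabilityMeasure PA]
    (Δ ρ ε : ℝ) (φ : ℝ → ℝ) (f : ℝ → (Fin p → ℝ) → ℝ) (d : ℕ → ℕ) : ℝ :=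
  -(∫ ω, Real.log (PoutEps PA Δ f ε (oneY φ f d L ρ ε Δ ω)
      (ρ * netOut φ d L ω.2.1 ω.2.2.1 ω.1)) ∂(oneMeasure d L p PA)) +
    ∫ ω, Real.log (Pout PA Δ f (oneY φ f d L ρ ε Δ ω) (oneSig φ d L p ρ ε ω))
      ∂(oneMeasure d L p PA)

lemma memLp_id_stdG (q : ENNReal) (hq : q ≠ ⊤) : MemLp (fun z : ℝ => z) q stdG :=
  memLp_id_gaussianReal' q hq

lemma integrable_pow_stdG (n : ℕ) : Integrable (fun z : ℝ => z ^ n) stdG := by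
  rcases Nat.eq_zero_or_pos n with rfl | hn
  · simp
  have h := (memLp_id_stdG n (by simp)).integrable_norm_pow hn.ne'
  refine (integrable_norm_iff (by fun_prop)).1 ?_
  simpa only [norm_pow] using h

lemma integral_sq_stdG : ∫ z, z ^ 2 ∂stdG = 1 := by
  have h := variance_fun_id_gaussianReal (μ := 0) (v := 1)
  rw [variance_of_integral_eq_zero (by fun_prop) (by simp)] at h
  simpa [stdG] using h

lemma map_sqrt_mul_stdG (v : ℝ) (hv : 0 ≤ v) :
    stdG.map (fun z => Real.sqrt v * z) = gaussianReal 0 v.toNNReal := by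
  unfold stdG
  rw [gaussianReal_map_const_mul]
  congr 1
  · simp
  · ext
    simp [Real.sq_sqrt hv, hv]

/-- A linear form in i.i.d. standard Gaussians is a centred Gaussian. -/
lemma map_linear_stdGPi {k : ℕ} (x : Fin k → ℝ) :
    (stdGPi k).map (fun a => ∑ i, a i * x i) =
      stdG.map (fun z => Real.sqrt (∑ i, x i ^ 2) * z) := by
  rw [map_sqrt_mul_stdG _ (Finset.sum_nonneg fun i _ => sq_nonneg _)]
  have hmem : ∀ i, MemLp (fun t : ℝ => t * x i) 2 stdG := fun i =>
    (memLp_id_stdG 2 (by simp)).mul_const (x i)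
  have hind : iIndepFun (fun i (a : Fin k → ℝ) => a i * x i) (stdGPi k) :=
    iIndepFun_pi (X := fun i (t : ℝ) => t * x i) fun i => by fun_prop
  have hG : HasGaussianLaw (fun a : Fin k → ℝ => ∑ i, a i * x i) (stdGPi k) := by
    refine iIndepFun.hasGaussianLaw_fun_sum (fun i => ⟨?_⟩) hind
    have : (stdGPi k).map (fun a => a i * x i) = stdG.map (fun t => t * x i) := by
      rw [← (measurePreserving_eval (fun _ : Fin k => stdG) i).map_eq,
        Measure.map_map (by fun_prop) (by fun_prop)]
      rfl
    rw [this]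
    unfold stdG
    rw [gaussianReal_map_mul_const]
    infer_instance
  rw [hG.map_eq_gaussianReal]
  have hint : ∀ i, ∫ a, a i * x i ∂(stdGPi k) = 0 := by
    intro i
    have := (measurePreserving_eval (fun _ : Fin k => stdG) i).map_eq
    have h2 : ∫ t, t * x i ∂((stdGPi k).map (Function.eval i)) = 0 := by
      unfold stdGPi
      rw [this, integral_mul_const]
      simp [stdG]
    rwa [integral_map (measurable_pi_apply i).aemeasurable (by fun_prop)] at h2
  congr 1
  · rw [integral_finsetSum]
    · exact Finset.sum_eq_zero fun i _ => hint i
    · intro i _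
      exact ((hmem i).comp_measurePreserving
        (measurePreserving_eval (fun _ : Fin k => stdG) i)).integrable (by simp)
  · congr 1
    have := variance_sum_pi (μ := fun _ : Fin k => stdG) (X := fun i t => t * x i) hmem
    have h2 : (∑ i, fun ω : Fin k → ℝ => ω i * x i) = fun a => ∑ i, a i * x i := by
      ext a; simp
    rw [h2] at this
    unfold stdGPi
    rw [this]
    refine Finset.sum_congr rfl fun i _ => ?_
    rw [variance_mul_const]
    simp [stdG]

lemma map_linear_div_sqrt {k : ℕ} (x : Fin k → ℝ) :
    (stdGPi k).map (fun a => (∑ i, a i * x i) / Real.sqrt (k : ℝ)) =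
      stdG.map (fun z => Real.sqrt ((∑ i, x i ^ 2) / k) * z) := by
  have h := congrArg (fun m => Measure.map (fun t => t / Real.sqrt (k : ℝ)) m)
    (map_linear_stdGPi x)
  rw [Measure.map_map (by fun_prop) (by fun_prop), Measure.map_map (by fun_prop) (by fun_prop)] at h
  have e : (fun z => Real.sqrt ((∑ i, x i ^ 2) / k) * z) =
      (fun t => t / Real.sqrt (k : ℝ)) ∘ fun z => Real.sqrt (∑ i, x i ^ 2) * z := by
    ext z
    simp only [Function.comp, Real.sqrt_div (Finset.sum_nonneg fun i _ => sq_nonneg (x i))]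
    ring
  rw [e, ← h]
  rfl

/-- The sum of two independent centred Gaussians. -/
lemma map_add_stdG_prod (u ε : ℝ) (hu : 0 ≤ u) (hε : 0 ≤ ε) :
    (stdG.prod stdG).map (fun g : ℝ × ℝ => g.1 * Real.sqrt u + Real.sqrt ε * g.2) =
      stdG.map (fun z => z * Real.sqrt (u + ε)) := by
  have e : (fun z : ℝ => z * Real.sqrt (u + ε)) = fun z => Real.sqrt (u + ε) * z := by
    ext; ring
  rw [e, map_sqrt_mul_stdG _ (by positivity), Real.toNNReal_add hu hε, ← add_zero (0 : ℝ),
    ← gaussianReal_conv_gaussianReal, ← map_sqrt_mul_stdG _ hu, ← map_sqrt_mul_stdG _ hε,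
    Measure.conv, Measure.map_prod_map _ _ (by fun_prop) (by fun_prop),
    Measure.map_map (by fun_prop) (by fun_prop)]
  congr 1
  ext g
  simp [mul_comm]

/-- The mean-square deviation of an empirical mean of i.i.d. variables. -/
lemma integral_sq_empirical_mean_sub_le {Ω : Type*} [MeasurableSpace Ω] (μ : Measure Ω)
    [IsProbabilityMeasure μ] {k : ℕ} (hk : 1 ≤ k) {h : Ω → ℝ} (hh : MemLp h 2 μ) :
    Integrable (fun w : Fin k → Ω => ((∑ i, h (w i)) / k - ∫ x, h x ∂μ) ^ 2)
      (Measure.pi fun _ => μ) ∧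
    ∫ w : Fin k → Ω, ((∑ i, h (w i)) / k - ∫ x, h x ∂μ) ^ 2 ∂(Measure.pi fun _ => μ)
      ≤ (∫ x, h x ^ 2 ∂μ) / k := by
  have hk0 : (0 : ℝ) < k := by exact_mod_cast hk
  have hmem : ∀ i : Fin k, MemLp (fun w : Fin k → Ω => h (w i)) 2 (Measure.pi fun _ => μ) :=
    fun i => hh.comp_measurePreserving (measurePreserving_eval (fun _ : Fin k => μ) i)
  have hS : MemLp (fun w : Fin k → Ω => ∑ i, h (w i)) 2 (Measure.pi fun _ => μ) :=
    memLp_finsetSum _ fun i _ => hmem i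
  have hD : MemLp (fun w : Fin k → Ω => (∑ i, h (w i)) / k) 2 (Measure.pi fun _ => μ) := by
    simpa only [div_eq_mul_inv] using hS.mul_const ((k : ℝ)⁻¹)
  have hi1 : ∀ i : Fin k, ∫ w : Fin k → Ω, h (w i) ∂(Measure.pi fun _ => μ) = ∫ x, h x ∂μ := by
    intro i
    have := (measurePreserving_eval (fun _ : Fin k => μ) i).map_eq
    conv_rhs => rw [← this]
    rw [integral_map (measurable_pi_apply i).aemeasurable
      (by rw [this]; exact hh.aestronglyMeasurable)]
  have hmean : ∫ w : Fin k → Ω, (∑ i, h (w i)) / k ∂(Measure.pi fun _ => μ) = ∫ x, h x ∂μ := by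
    rw [integral_div, integral_finsetSum _ fun i _ => (hmem i).integrable (by simp)]
    simp only [hi1, Finset.sum_const, Finset.card_univ, Fintype.card_fin, nsmul_eq_mul]
    field_simp
  constructor
  · exact (hD.sub (memLp_const _)).integrable_sq
  · have hv := variance_eq_integral hD.aestronglyMeasurable.aemeasurable
    rw [hmean] at hv
    rw [← hv]
    have h3 : Var[fun w : Fin k → Ω => (∑ i, h (w i)) / k; Measure.pi fun _ => μ] =
        (k : ℝ)⁻¹ ^ 2 * (k * Var[h; μ]) := by
      have := variance_sum_pi (μ := fun _ : Fin k => μ) (X := fun _ => h) fun _ => hh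
      have h2 : (∑ i : Fin k, fun ω : Fin k → Ω => h (ω i)) = fun w => ∑ i, h (w i) := by
        ext a; simp
      rw [h2] at this
      simp only [div_eq_inv_mul]
      rw [variance_const_mul, this]
      simp
    rw [h3]
    have h4 : Var[h; μ] ≤ ∫ x, h x ^ 2 ∂μ := variance_le_expectation_sq hh.aestronglyMeasurable
    rw [le_div_iff₀ hk0]
    calc (k : ℝ)⁻¹ ^ 2 * (k * Var[h; μ]) * k = Var[h; μ] := by field_simp
      _ ≤ _ := h4

/-- Resampling one coordinate preserves a product of probability measures. -/
lemma measurePreserving_update {ι : Type*} [Fintype ι] [DecidableEq ι] {α : ι → Type*}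
    [∀ i, MeasurableSpace (α i)] (μ : ∀ i, Measure (α i)) [∀ i, IsProbabilityMeasure (μ i)]
    (i : ι) :
    MeasurePreserving (fun q : (∀ j, α j) × α i => Function.update q.1 i q.2)
      ((Measure.pi μ).prod (μ i)) (Measure.pi μ) := by
  have hm : Measurable fun q : (∀ j, α j) × α i => Function.update q.1 i q.2 :=
    measurable_update'.comp measurable_id
  refine ⟨hm, (Measure.pi_eq fun s hs => ?_).symm⟩
  rw [Measure.map_apply hm (MeasurableSet.univ_pi hs)]
  have e : (fun q : (∀ j, α j) × α i => Function.update q.1 i q.2) ⁻¹' Set.univ.pi s =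
      (Set.univ.pi (Function.update s i Set.univ)) ×ˢ s i := by
    ext ⟨W, w⟩
    simp only [Set.mem_preimage, Set.mem_univ_pi, Set.mem_prod]
    constructor
    · intro h
      refine ⟨fun j => ?_, by simpa using h i⟩
      by_cases hj : j = i
      · subst hj; simp
      · simpa [hj] using h j
    · rintro ⟨h1, h2⟩ j
      by_cases hj : j = i
      · subst hj; simpa using h2
      · simpa [hj] using h1 j
  rw [e, Measure.prod_prod, Measure.pi_pi, ← Finset.prod_erase_mul _ _ (Finset.mem_univ i),
    ← Finset.prod_erase_mul Finset.univ (fun j => μ j (s j)) (Finset.mem_univ i)]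
  simp only [Function.update_self, measure_univ, mul_one]
  congr 1
  refine Finset.prod_congr rfl fun j hj => ?_
  rw [Function.update_of_ne (Finset.ne_of_mem_erase hj)]

lemma feat_congr (φ : ℝ → ℝ) (d : ℕ → ℕ)
    {W W' : (ℓ : ℕ) → Fin (d (ℓ + 1)) → Fin (d ℓ) → ℝ} (x0 : Fin (d 0) → ℝ) :
    ∀ ℓ : ℕ, (∀ k < ℓ, W k = W' k) → feat φ d W x0 ℓ = feat φ d W' x0 ℓ
  | 0, _ => rfl
  | ℓ + 1, h => by
    funext i
    simp only [feat]
    rw [feat_congr φ d x0 ℓ fun k hk => h k (by omega), h ℓ (by omega)]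

lemma extW_update_of_ne {d : ℕ → ℕ} {L : ℕ} (W : Wspace d L) {ℓ : ℕ} (h : ℓ < L)
    (w : Fin (d (ℓ + 1)) → Fin (d ℓ) → ℝ) {k : ℕ} (hk : k ≠ ℓ) :
    extW (Function.update W ⟨ℓ, h⟩ w) k = extW W k := by
  unfold extW
  split_ifs with h'
  · rw [Function.update_of_ne]
    simpa [Fin.ext_iff] using hk
  · rfl

lemma extW_update_self {d : ℕ → ℕ} {L : ℕ} (W : Wspace d L) {ℓ : ℕ} (h : ℓ < L)
    (w : Fin (d (ℓ + 1)) → Fin (d ℓ) → ℝ) :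
    extW (Function.update W ⟨ℓ, h⟩ w) ℓ = w := by
  unfold extW
  rw [dif_pos h]
  exact Function.update_self (β := fun ℓ : Fin L => Fin (d ((ℓ : ℕ) + 1)) → Fin (d (ℓ : ℕ)) → ℝ)
    ⟨ℓ, h⟩ w W

lemma measurable_feat {φ : ℝ → ℝ} (hφ : Measurable φ) (d : ℕ → ℕ) (L : ℕ) (ℓ : ℕ) :
    Measurable fun q : (Fin (d 0) → ℝ) × Wspace d L => feat φ d (extW q.2) q.1 ℓ := by
  induction ℓ with
  | zero => exact measurable_fst
  | succ ℓ ih =>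
    refine measurable_pi_iff.2 fun i => ?_
    simp only [feat]
    refine hφ.comp (Measurable.div_const (Finset.measurable_sum _ fun j _ => ?_) _)
    refine Measurable.mul ?_ ((measurable_pi_apply j).comp ih)
    unfold extW
    split_ifs with h
    · exact (measurable_pi_apply j).comp ((measurable_pi_apply i).comp
        ((measurable_pi_apply (⟨ℓ, h⟩ : Fin L)).comp measurable_snd))
    · exact measurable_const

/-- Normalised squared norm of the `ℓ`-th post-activation vector. -/
def featVar (φ : ℝ → ℝ) (d : ℕ → ℕ) (W : (ℓ : ℕ) → Fin (d (ℓ + 1)) → Fin (d ℓ) → ℝ)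
    (x0 : Fin (d 0) → ℝ) (ℓ : ℕ) : ℝ :=
  (∑ i, feat φ d W x0 ℓ i ^ 2) / d ℓ

lemma featVar_nonneg (φ : ℝ → ℝ) (d : ℕ → ℕ)
    (W : (ℓ : ℕ) → Fin (d (ℓ + 1)) → Fin (d ℓ) → ℝ) (x0 : Fin (d 0) → ℝ) (ℓ : ℕ) :
    0 ≤ featVar φ d W x0 ℓ :=
  div_nonneg (Finset.sum_nonneg fun _ _ => sq_nonneg _) (Nat.cast_nonneg _)

lemma measurable_featVar {φ : ℝ → ℝ} (hφ : Measurable φ) (d : ℕ → ℕ) (L : ℕ) (ℓ : ℕ) :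
    Measurable fun q : (Fin (d 0) → ℝ) × Wspace d L => featVar φ d (extW q.2) q.1 ℓ := by
  unfold featVar
  refine Measurable.div_const (Finset.measurable_sum _ fun i _ => ?_) _
  exact ((measurable_pi_apply i).comp (measurable_feat hφ d L ℓ)).pow_const 2

lemma lintegral_layer {φ : ℝ → ℝ} (hφ : Measurable φ) (d : ℕ → ℕ) {L ℓ : ℕ} (h : ℓ < L)
    {Φ : (Fin (d (ℓ + 1)) → ℝ) → ENNReal} (hΦ : Measurable Φ) :
    ∫⁻ q, Φ (feat φ d (extW q.2) q.1 (ℓ + 1)) ∂((stdGPi (d 0)).prod (Wmeasure d L)) =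
      ∫⁻ q, ∫⁻ w, Φ (fun i => φ ((∑ j, w i j * feat φ d (extW q.2) q.1 ℓ j) /
          Real.sqrt (d ℓ : ℝ))) ∂(Measure.pi fun _ : Fin (d (ℓ + 1)) => stdGPi (d ℓ))
        ∂((stdGPi (d 0)).prod (Wmeasure d L)) := by
  have hf := measurable_feat hφ d L ℓ
  have hm1 : Measurable fun q : (Fin (d 0) → ℝ) × Wspace d L =>
      Φ (feat φ d (extW q.2) q.1 (ℓ + 1)) := hΦ.comp (measurable_feat hφ d L (ℓ + 1))
  have hm2 : Measurable fun r : ((Fin (d 0) → ℝ) × Wspace d L) ×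
      (Fin (d (ℓ + 1)) → Fin (d ℓ) → ℝ) =>
      Φ (fun i => φ ((∑ j, r.2 i j * feat φ d (extW r.1.2) r.1.1 ℓ j) /
          Real.sqrt (d ℓ : ℝ))) := by
    refine hΦ.comp (measurable_pi_iff.2 fun i => hφ.comp
      (Measurable.div_const (Finset.measurable_sum _ fun j _ => Measurable.mul ?_ ?_) _))
    · exact (measurable_pi_apply j).comp ((measurable_pi_apply i).comp measurable_snd)
    · exact (measurable_pi_apply j).comp (hf.comp measurable_fst)
  have hm3 := hm2.lintegral_prod_right'
    (ν := Measure.pi fun _ : Fin (d (ℓ + 1)) => stdGPi (d ℓ))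
  rw [lintegral_prod _ hm1.aemeasurable, lintegral_prod _ hm3.aemeasurable]
  refine lintegral_congr fun x0 => ?_
  have hmp := measurePreserving_update
    (fun k : Fin L => Measure.pi fun _ : Fin (d ((k : ℕ) + 1)) => stdGPi (d (k : ℕ))) ⟨ℓ, h⟩
  have hm4 : Measurable fun W : Wspace d L => Φ (feat φ d (extW W) x0 (ℓ + 1)) :=
    hm1.comp (measurable_const.prodMk measurable_id)
  have := hmp.lintegral_comp hm4
  unfold Wmeasure
  rw [← this]
  refine (lintegral_prod _ (hm4.comp hmp.measurable).aemeasurable).trans ?_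
  refine lintegral_congr fun W => lintegral_congr fun w => ?_
  refine congrArg Φ (funext fun i => ?_)
  simp only [feat]
  rw [extW_update_self, feat_congr φ d x0 ℓ fun k hk => extW_update_of_ne W h w hk.ne]

lemma abs_le_mul_abs_of_lipschitz {φ : ℝ → ℝ} {K : ℝ} (hK : ∀ x y, |φ x - φ y| ≤ K * |x - y|)
    (h0 : φ 0 = 0) (x : ℝ) : |φ x| ≤ K * |x| := by
  simpa [h0] using hK x 0

lemma integrable_sq_comp_stdG {φ : ℝ → ℝ} (hφ : Continuous φ) {K : ℝ}
    (hK : ∀ x y, |φ x - φ y| ≤ K * |x - y|) (h0 : φ 0 = 0) (c : ℝ) :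
    Integrable (fun z => φ (c * z) ^ 2) stdG := by
  refine ((integrable_pow_stdG 2).const_mul (K ^ 2 * c ^ 2)).mono' (by fun_prop)
    (.of_forall fun z => ?_)
  have h := pow_le_pow_left₀ (abs_nonneg _) (abs_le_mul_abs_of_lipschitz hK h0 (c * z)) 2
  rw [Real.norm_of_nonneg (sq_nonneg _)]
  rw [sq_abs, mul_pow, sq_abs] at h
  linarith

lemma integrable_pow_four_comp_stdG {φ : ℝ → ℝ} (hφ : Continuous φ) {K : ℝ}
    (hK : ∀ x y, |φ x - φ y| ≤ K * |x - y|) (h0 : φ 0 = 0) (c : ℝ) :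
    Integrable (fun z => (φ (c * z) ^ 2) ^ 2) stdG ∧
    ∫ z, (φ (c * z) ^ 2) ^ 2 ∂stdG ≤ K ^ 4 * c ^ 4 * ∫ z, z ^ 4 ∂stdG := by
  have hb : ∀ z, (φ (c * z) ^ 2) ^ 2 ≤ K ^ 4 * c ^ 4 * z ^ 4 := by
    intro z
    have h := pow_le_pow_left₀ (abs_nonneg _) (abs_le_mul_abs_of_lipschitz hK h0 (c * z)) 4
    have e1 : |φ (c * z)| ^ 4 = (φ (c * z) ^ 2) ^ 2 := by
      rw [← sq_abs (φ (c * z))]; ring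
    have e2 : (K * |c * z|) ^ 4 = K ^ 4 * c ^ 4 * z ^ 4 := by
      have : |c * z| ^ 4 = (|c * z| ^ 2) ^ 2 := by ring
      rw [mul_pow, this, sq_abs]; ring
    rw [e1, e2] at h
    exact h
  have hi := (integrable_pow_stdG 4).const_mul (K ^ 4 * c ^ 4)
  have hi' : Integrable (fun z => (φ (c * z) ^ 2) ^ 2) stdG :=
    hi.mono' (by fun_prop) (.of_forall fun z => by
      rw [Real.norm_of_nonneg (sq_nonneg _)]; exact hb z)
  refine ⟨hi', ?_⟩
  rw [← integral_const_mul]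
  exact integral_mono hi' hi hb

lemma abs_integral_sq_sub_le {φ : ℝ → ℝ} (hφ : Continuous φ) {K : ℝ}
    (hK : ∀ x y, |φ x - φ y| ≤ K * |x - y|) (h0 : φ 0 = 0) {u v : ℝ} (hu : 0 ≤ u) (hv : 0 ≤ v) :
    |(∫ z, φ (Real.sqrt u * z) ^ 2 ∂stdG) - ∫ z, φ (Real.sqrt v * z) ^ 2 ∂stdG|
      ≤ K ^ 2 * |u - v| := by
  have hK0 : 0 ≤ K := by
    have := (abs_nonneg _).trans (hK 1 0)
    simpa using this
  rw [← integral_sub (integrable_sq_comp_stdG hφ hK h0 _) (integrable_sq_comp_stdG hφ hK h0 _)]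
  have hb : ∀ z, ‖φ (Real.sqrt u * z) ^ 2 - φ (Real.sqrt v * z) ^ 2‖ ≤
      K ^ 2 * |u - v| * z ^ 2 := by
    intro z
    have h1 := hK (Real.sqrt u * z) (Real.sqrt v * z)
    have h2 : |φ (Real.sqrt u * z) + φ (Real.sqrt v * z)| ≤
        K * ((Real.sqrt u + Real.sqrt v) * |z|) := by
      refine (abs_add_le _ _).trans ?_
      have a1 := abs_le_mul_abs_of_lipschitz hK h0 (Real.sqrt u * z)
      have a2 := abs_le_mul_abs_of_lipschitz hK h0 (Real.sqrt v * z)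
      rw [abs_mul, abs_of_nonneg (Real.sqrt_nonneg _)] at a1 a2
      linarith
    have h3 : |Real.sqrt u * z - Real.sqrt v * z| = |Real.sqrt u - Real.sqrt v| * |z| := by
      rw [← abs_mul]; congr 1; ring
    have h4 : |Real.sqrt u - Real.sqrt v| * (Real.sqrt u + Real.sqrt v) = |u - v| := by
      rw [← abs_of_nonneg (add_nonneg (Real.sqrt_nonneg u) (Real.sqrt_nonneg v)), ← abs_mul]
      congr 1
      nlinarith [Real.sq_sqrt hu, Real.sq_sqrt hv]
    rw [Real.norm_eq_abs, sq_sub_sq, abs_mul]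
    calc _ ≤ K * ((Real.sqrt u + Real.sqrt v) * |z|) *
          (K * (|Real.sqrt u - Real.sqrt v| * |z|)) := by
          rw [← h3]; gcongr
      _ = K ^ 2 * (|Real.sqrt u - Real.sqrt v| * (Real.sqrt u + Real.sqrt v)) * |z| ^ 2 := by ring
      _ = _ := by rw [h4, sq_abs]
  have := norm_integral_le_of_norm_le ((integrable_pow_stdG 2).const_mul _) (.of_forall hb)
  rwa [integral_const_mul, integral_sq_stdG, mul_one, Real.norm_eq_abs] at this

lemma sigmaC_nonneg (φ : ℝ → ℝ) : ∀ ℓ, 0 ≤ sigmaC φ ℓ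
  | 0 => zero_le_one
  | _ + 1 => integral_nonneg fun _ => sq_nonneg _

lemma lintegral_layer_deviation_le {φ : ℝ → ℝ} (hφ : Continuous φ) {K : ℝ}
    (hK : ∀ x y, |φ x - φ y| ≤ K * |x - y|) (h0 : φ 0 = 0) {k m : ℕ} (hm : 1 ≤ m)
    (x : Fin k → ℝ) {s : ℝ} (hs : 0 ≤ s) {D : ℝ} (hD : 0 < D) (hDm : D ≤ m) :
    ∫⁻ w, ENNReal.ofReal (((∑ i, φ ((∑ j, w i j * x j) / Real.sqrt (k : ℝ)) ^ 2) / m -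
        ∫ z, φ (z * Real.sqrt s) ^ 2 ∂stdG) ^ 2) ∂(Measure.pi fun _ : Fin m => stdGPi k) ≤
      ENNReal.ofReal (4 * K ^ 4 * (∫ z, z ^ 4 ∂stdG) * s ^ 2 / D +
        (4 * K ^ 4 * (∫ z, z ^ 4 ∂stdG) + 2 * K ^ 4) * ((∑ i, x i ^ 2) / k - s) ^ 2) := by
  set q := (∑ i, x i ^ 2) / (k : ℝ) with hq
  have hq0 : 0 ≤ q := div_nonneg (Finset.sum_nonneg fun _ _ => sq_nonneg _) (Nat.cast_nonneg _)
  have hm1 : (1 : ℝ) ≤ m := by exact_mod_cast hm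
  set M := ∫ z, z ^ 4 ∂stdG with hM
  have hM0 : 0 ≤ M := integral_nonneg fun z => by positivity
  set h : (Fin k → ℝ) → ℝ := fun a => φ ((∑ j, a j * x j) / Real.sqrt (k : ℝ)) ^ 2 with hh
  have hmeas : Measurable fun a : Fin k → ℝ => (∑ j, a j * x j) / Real.sqrt (k : ℝ) := by fun_prop
  have hlaw := map_linear_div_sqrt x
  have hmem : MemLp h 2 (stdGPi k) := by
    rw [memLp_two_iff_integrable_sq (by fun_prop)]
    have := (integrable_pow_four_comp_stdG hφ hK h0 (Real.sqrt q)).1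
    have h2 : Integrable (fun t => (φ t ^ 2) ^ 2) (stdG.map fun z => Real.sqrt q * z) := by
      rw [integrable_map_measure (by fun_prop) (by fun_prop)]
      exact this
    rw [← hlaw, integrable_map_measure (by fun_prop) hmeas.aemeasurable] at h2
    exact h2
  have hint : ∀ F : ℝ → ℝ, Continuous F →
      ∫ a, F ((∑ j, a j * x j) / Real.sqrt (k : ℝ)) ∂(stdGPi k) =
        ∫ z, F (Real.sqrt q * z) ∂stdG := by
    intro F hF
    rw [← integral_map hmeas.aemeasurable hF.aestronglyMeasurable, hlaw,
      integral_map (by fun_prop) hF.aestronglyMeasurable]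
  obtain ⟨hI, hle⟩ := integral_sq_empirical_mean_sub_le (stdGPi k) hm hmem
  have e1 : ∫ a, h a ∂(stdGPi k) = ∫ z, φ (Real.sqrt q * z) ^ 2 ∂stdG :=
    hint (fun t => φ t ^ 2) (by fun_prop)
  have e2 : ∫ a, h a ^ 2 ∂(stdGPi k) ≤ K ^ 4 * q ^ 2 * M := by
    have := hint (fun t => (φ t ^ 2) ^ 2) (by fun_prop)
    rw [show ∫ a, h a ^ 2 ∂(stdGPi k) = _ from this]
    have h4 := (integrable_pow_four_comp_stdG hφ hK h0 (Real.sqrt q)).2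
    have : Real.sqrt q ^ 4 = q ^ 2 := by
      rw [show Real.sqrt q ^ 4 = (Real.sqrt q ^ 2) ^ 2 by ring, Real.sq_sqrt hq0]
    rwa [this] at h4
  have e3 : ∫ z, φ (z * Real.sqrt s) ^ 2 ∂stdG = ∫ z, φ (Real.sqrt s * z) ^ 2 ∂stdG := by
    simp only [mul_comm]
  have hg := abs_integral_sq_sub_le hφ hK h0 hq0 hs
  rw [e3]
  set g := ∫ z, φ (Real.sqrt q * z) ^ 2 ∂stdG
  set g' := ∫ z, φ (Real.sqrt s * z) ^ 2 ∂stdG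
  rw [e1] at hI hle
  have hg2 : (g - g') ^ 2 ≤ K ^ 4 * (q - s) ^ 2 := by
    have := pow_le_pow_left₀ (abs_nonneg _) hg 2
    rw [sq_abs, mul_pow, sq_abs] at this
    calc _ ≤ _ := this
      _ = _ := by ring
  calc _ ≤ ∫⁻ w, ENNReal.ofReal (2 * ((∑ i, h (w i)) / m - g) ^ 2 + 2 * (K ^ 4 * (q - s) ^ 2))
        ∂(Measure.pi fun _ : Fin m => stdGPi k) := by
        refine lintegral_mono fun w => ENNReal.ofReal_le_ofReal ?_
        change ((∑ i, h (w i)) / m - g') ^ 2 ≤ _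
        nlinarith [sq_nonneg (((∑ i, h (w i)) / m - g) - (g - g'))]
    _ = ENNReal.ofReal (∫ w, (2 * ((∑ i, h (w i)) / m - g) ^ 2 + 2 * (K ^ 4 * (q - s) ^ 2))
        ∂(Measure.pi fun _ : Fin m => stdGPi k)) := by
        rw [ofReal_integral_eq_lintegral_ofReal]
        · exact (hI.const_mul 2).add (integrable_const _)
        · exact .of_forall fun w => by positivity
    _ ≤ _ := by
        refine ENNReal.ofReal_le_ofReal ?_
        rw [integral_add (hI.const_mul 2) (integrable_const _), integral_const_mul]
        simp only [integral_const, probReal_univ, smul_eq_mul, one_mul]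
        have a1 : (∫ a, h a ^ 2 ∂(stdGPi k)) / m ≤
            2 * K ^ 4 * M * s ^ 2 / D + 2 * K ^ 4 * M * (q - s) ^ 2 := by
          calc _ ≤ K ^ 4 * q ^ 2 * M / m := by gcongr
            _ ≤ K ^ 4 * (2 * s ^ 2 + 2 * (q - s) ^ 2) * M / m := by
              gcongr
              nlinarith [sq_nonneg (q - 2 * s)]
            _ = 2 * K ^ 4 * M * s ^ 2 / m + 2 * K ^ 4 * M * (q - s) ^ 2 / m := by ring
            _ ≤ _ := by
              gcongr
              exact div_le_self (by positivity) hm1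
        have a2 : 4 * K ^ 4 * M * s ^ 2 / D = 2 * (2 * K ^ 4 * M * s ^ 2 / D) := by ring
        rw [a2]
        linarith

/-- The squared norms of the post-activations concentrate at rate `1 / d_m` in mean square. -/
lemma lintegral_featVar_deviation_le {φ : ℝ → ℝ} (hφ : Continuous φ) {K : ℝ}
    (hK : ∀ x y, |φ x - φ y| ≤ K * |x - y|) (h0 : φ 0 = 0) (ℓ : ℕ) :
    ∃ C : ℝ, 0 ≤ C ∧ ∀ (L : ℕ) (d : ℕ → ℕ) (D : ℝ), ℓ ≤ L → 0 < D → (∀ k ≤ L, 1 ≤ d k) →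
      (∀ k ≤ L, D ≤ d k) →
      ∫⁻ q, ENNReal.ofReal ((featVar φ d (extW q.2) q.1 ℓ - sigmaC φ ℓ) ^ 2)
        ∂((stdGPi (d 0)).prod (Wmeasure d L)) ≤ ENNReal.ofReal (C / D) := by
  have hM0 : 0 ≤ ∫ z, z ^ 4 ∂stdG := integral_nonneg fun z => by positivity
  induction ℓ with
  | zero =>
    refine ⟨∫ z, z ^ 4 ∂stdG, hM0, fun L d D _ hD h1 hDd => ?_⟩
    have hmem : MemLp (fun z : ℝ => z ^ 2) 2 stdG := by
      rw [memLp_two_iff_integrable_sq (by fun_prop)]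
      simpa only [← pow_mul] using integrable_pow_stdG 4
    obtain ⟨hI, hle⟩ := integral_sq_empirical_mean_sub_le stdG (h1 0 (by omega)) hmem
    have hm : Measurable fun q : (Fin (d 0) → ℝ) × Wspace d L =>
        ENNReal.ofReal ((featVar φ d (extW q.2) q.1 0 - sigmaC φ 0) ^ 2) :=
      (((measurable_featVar hφ.measurable d L 0).sub_const _).pow_const 2).ennreal_ofReal
    rw [lintegral_prod _ hm.aemeasurable]
    simp only [featVar, feat, sigmaC, lintegral_const, measure_univ, mul_one]
    rw [integral_sq_stdG] at hI hle
    unfold stdGPi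
    rw [← ofReal_integral_eq_lintegral_ofReal hI (.of_forall fun _ => sq_nonneg _)]
    refine ENNReal.ofReal_le_ofReal (hle.trans ?_)
    simp only [← pow_mul]
    exact div_le_div_of_nonneg_left hM0 hD (hDd 0 (by omega))
  | succ ℓ ih =>
    obtain ⟨C, hC, ih⟩ := ih
    set M := ∫ z, z ^ 4 ∂stdG with hM
    set s := sigmaC φ ℓ with hs
    have hs0 : 0 ≤ s := sigmaC_nonneg φ ℓ
    set A := 4 * K ^ 4 * M * s ^ 2
    set B := 4 * K ^ 4 * M + 2 * K ^ 4
    have hB0 : 0 ≤ B := by positivity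
    refine ⟨A + B * C, by positivity, fun L d D hℓ hD h1 hDd => ?_⟩
    have hΦ : Measurable fun y : Fin (d (ℓ + 1)) → ℝ => ENNReal.ofReal
        (((∑ i, y i ^ 2) / (d (ℓ + 1) : ℕ) - sigmaC φ (ℓ + 1)) ^ 2) := by fun_prop
    refine (lintegral_layer hφ.measurable d hℓ hΦ).le.trans ?_
    calc _ ≤ ∫⁻ q, ENNReal.ofReal (A / D + B * (featVar φ d (extW q.2) q.1 ℓ - s) ^ 2)
          ∂((stdGPi (d 0)).prod (Wmeasure d L)) :=
          lintegral_mono fun q => lintegral_layer_deviation_le hφ hK h0 (h1 _ hℓ)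
            (feat φ d (extW q.2) q.1 ℓ) hs0 hD (hDd _ hℓ)
      _ = ENNReal.ofReal (A / D) + ENNReal.ofReal B *
          ∫⁻ q, ENNReal.ofReal ((featVar φ d (extW q.2) q.1 ℓ - s) ^ 2)
          ∂((stdGPi (d 0)).prod (Wmeasure d L)) := by
          have hm : Measurable fun q : (Fin (d 0) → ℝ) × Wspace d L =>
              ENNReal.ofReal ((featVar φ d (extW q.2) q.1 ℓ - s) ^ 2) :=
            (((measurable_featVar hφ.measurable d L ℓ).sub_const _).pow_const 2).ennreal_ofReal
          rw [← lintegral_const_mul _ hm]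
          simp only [ENNReal.ofReal_add (show 0 ≤ A / D by positivity)
            (mul_nonneg hB0 (sq_nonneg _)), ENNReal.ofReal_mul hB0]
          rw [lintegral_add_left measurable_const]
          simp
      _ ≤ ENNReal.ofReal (A / D) + ENNReal.ofReal B * ENNReal.ofReal (C / D) := by
          gcongr
          exact ih L d D (by omega) hD h1 hDd
      _ = _ := by
          rw [← ENNReal.ofReal_mul hB0, ← ENNReal.ofReal_add (by positivity) (by positivity)]
          congr 1
          ring

/-- Local Lipschitz bound with quadratically growing constant. -/
def QuadLip (F : ℝ → ℝ) (B : ℝ) : Prop :=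
  ∀ t t', |F t - F t'| ≤ B * |t - t'| * (1 + t ^ 2 + t' ^ 2)

lemma QuadLip.nonneg {F : ℝ → ℝ} {B : ℝ} (h : QuadLip F B) : 0 ≤ B := by
  have := (abs_nonneg _).trans (h 1 0)
  norm_num at this
  linarith

lemma QuadLip.continuous {F : ℝ → ℝ} {B : ℝ} (h : QuadLip F B) : Continuous F := by
  refine continuous_iff_continuousAt.2 fun t => ?_
  rw [ContinuousAt, tendsto_iff_norm_sub_tendsto_zero]
  refine squeeze_zero (fun _ => norm_nonneg _) (fun t' => h t' t) ?_
  have : Continuous fun t' => B * |t' - t| * (1 + t' ^ 2 + t ^ 2) := by fun_prop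
  simpa using this.tendsto t

lemma QuadLip.abs_le {F : ℝ → ℝ} {B : ℝ} (h : QuadLip F B) (t : ℝ) :
    |F t| ≤ |F 0| + B * (2 + 2 * t ^ 4) := by
  have h1 := h t 0
  have hB := h.nonneg
  have h2 : |F t| ≤ |F 0| + |F t - F 0| := by
    have := abs_add_le (F 0) (F t - F 0)
    simpa using this
  have h3 : |t| * (1 + t ^ 2) ≤ 2 + 2 * t ^ 4 := by
    rw [← sq_abs t, show t ^ 4 = (|t|) ^ 4 by rw [← Even.pow_abs (by decide) t]]
    nlinarith [sq_nonneg (|t| ^ 2 - |t|), sq_nonneg (|t| - 1), sq_nonneg (|t| ^ 2 - 1),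
      abs_nonneg t]
  have h4 : B * |t - 0| * (1 + t ^ 2 + 0 ^ 2) ≤ B * (2 + 2 * t ^ 4) := by
    rw [mul_assoc]
    refine mul_le_mul_of_nonneg_left ?_ hB
    simpa using h3
  linarith

lemma QuadLip.integrable_comp {F : ℝ → ℝ} {B : ℝ} (h : QuadLip F B) {Ω : Type*}
    [MeasurableSpace Ω] {μ : Measure Ω} [IsFiniteMeasure μ] {X : Ω → ℝ}
    (hX : AEMeasurable X μ) (h4 : Integrable (fun ω => X ω ^ 4) μ) :
    Integrable (fun ω => F (X ω)) μ := by
  refine ((integrable_const |F 0|).add (((integrable_const 2).add (h4.const_mul 2)).const_mul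
    B)).mono' (h.continuous.measurable.comp_aemeasurable hX).aestronglyMeasurable
    (.of_forall fun ω => h.abs_le _)

lemma integrable_mul_pow_four_stdG (c : ℝ) : Integrable (fun z => (c * z) ^ 4) stdG := by
  simpa only [mul_pow] using (integrable_pow_stdG 4).const_mul (c ^ 4)

/-- Law of the readout of a random network on a random input. -/
def netLaw (φ : ℝ → ℝ) (d : ℕ → ℕ) (L : ℕ) : Measure ℝ :=
  (((stdGPi (d 0)).prod (Wmeasure d L)).prod (stdGPi (d L))).map
    fun q => netOut φ d L q.1.2 q.2 q.1.1

lemma measurable_netOut {φ : ℝ → ℝ} (hφ : Measurable φ) (d : ℕ → ℕ) (L : ℕ) :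
    Measurable fun q : ((Fin (d 0) → ℝ) × Wspace d L) × (Fin (d L) → ℝ) =>
      netOut φ d L q.1.2 q.2 q.1.1 := by
  unfold netOut
  refine Measurable.div_const (Finset.measurable_sum _ fun j _ => Measurable.mul ?_ ?_) _
  · exact (measurable_pi_apply j).comp measurable_snd
  · exact (measurable_pi_apply j).comp ((measurable_feat hφ d L L).comp measurable_fst)

lemma isProbabilityMeasure_netLaw {φ : ℝ → ℝ} (hφ : Measurable φ) (d : ℕ → ℕ) (L : ℕ) :
    IsProbabilityMeasure (netLaw φ d L) :=
  Measure.isProbabilityMeasure_map (measurable_netOut hφ d L).aemeasurable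

/-- The readout is a Gaussian scale mixture. -/
lemma netLaw_eq {φ : ℝ → ℝ} (hφ : Measurable φ) (d : ℕ → ℕ) (L : ℕ) :
    netLaw φ d L = (((stdGPi (d 0)).prod (Wmeasure d L)).prod stdG).map
      fun q => Real.sqrt (featVar φ d (extW q.1.2) q.1.1 L) * q.2 := by
  have hv := measurable_featVar hφ d L L
  have hm : Measurable fun q : ((Fin (d 0) → ℝ) × Wspace d L) × ℝ =>
      Real.sqrt (featVar φ d (extW q.1.2) q.1.1 L) * q.2 :=
    (Real.continuous_sqrt.measurable.comp (hv.comp measurable_fst)).mul measurable_snd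
  have hn := measurable_netOut hφ d L
  ext s hs
  unfold netLaw
  rw [← lintegral_indicator_one hs, ← lintegral_indicator_one hs]
  have hind : Measurable (s.indicator (1 : ℝ → ENNReal)) := measurable_one.indicator hs
  rw [lintegral_map hind hn, lintegral_map hind hm]
  refine (lintegral_prod _ (hind.comp hn).aemeasurable).trans
    (Eq.trans (lintegral_congr fun q => ?_) (lintegral_prod _ (hind.comp hm).aemeasurable).symm)
  have := congrArg (fun m => ∫⁻ t, s.indicator (1 : ℝ → ENNReal) t ∂m)
    (map_linear_div_sqrt (feat φ d (extW q.2) q.1 L))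
  rw [lintegral_map hind (by fun_prop), lintegral_map hind (by fun_prop)] at this
  exact this

lemma eq_zero_of_sigmaC_eq_zero {φ : ℝ → ℝ} (hφ : Continuous φ) {K : ℝ}
    (hK : ∀ x y, |φ x - φ y| ≤ K * |x - y|) (h0 : φ 0 = 0) (ℓ : ℕ) (hσ : sigmaC φ ℓ = 0) :
    1 ≤ ℓ ∧ φ = 0 := by
  induction ℓ with
  | zero => simp [sigmaC] at hσ
  | succ ℓ ih =>
    refine ⟨by omega, ?_⟩
    by_cases hℓ : sigmaC φ ℓ = 0
    · exact (ih hℓ).2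
    have hpos : 0 < Real.sqrt (sigmaC φ ℓ) :=
      Real.sqrt_pos.2 (lt_of_le_of_ne (sigmaC_nonneg φ ℓ) (Ne.symm hℓ))
    have hi : Integrable (fun z => φ (z * Real.sqrt (sigmaC φ ℓ)) ^ 2) stdG := by
      simpa only [mul_comm] using integrable_sq_comp_stdG hφ hK h0 (Real.sqrt (sigmaC φ ℓ))
    rw [sigmaC, integral_eq_zero_iff_of_nonneg (fun _ => sq_nonneg _) hi] at hσ
    have hvol : (fun z => φ (z * Real.sqrt (sigmaC φ ℓ)) ^ 2) =ᵐ[volume] 0 :=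
      (gaussianReal_absolutelyContinuous' 0 one_ne_zero).ae_le hσ
    have heq := (Continuous.ae_eq_iff_eq volume (by fun_prop) continuous_zero).1 hvol
    funext x
    have := congrFun heq (x / Real.sqrt (sigmaC φ ℓ))
    simpa [div_mul_cancel₀ _ hpos.ne'] using this

lemma featVar_zero_fun (d : ℕ → ℕ) {L : ℕ} (hL : 1 ≤ L)
    (W : (ℓ : ℕ) → Fin (d (ℓ + 1)) → Fin (d ℓ) → ℝ) (x0 : Fin (d 0) → ℝ) :
    featVar 0 d W x0 L = 0 := by
  obtain ⟨ℓ, rfl⟩ : ∃ ℓ, L = ℓ + 1 := ⟨L - 1, by omega⟩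
  simp [featVar, feat]

lemma exists_abs_sqrt_featVar_sub_le {φ : ℝ → ℝ} (hφ : Continuous φ) {K : ℝ}
    (hK : ∀ x y, |φ x - φ y| ≤ K * |x - y|) (h0 : φ 0 = 0) (L : ℕ) :
    ∃ κ : ℝ, 0 ≤ κ ∧ ∀ d W x0, |Real.sqrt (featVar φ d W x0 L) - Real.sqrt (sigmaC φ L)| ≤
      κ * |featVar φ d W x0 L - sigmaC φ L| := by
  by_cases hσ : sigmaC φ L = 0
  · obtain ⟨hL, rfl⟩ := eq_zero_of_sigmaC_eq_zero hφ hK h0 L hσ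
    refine ⟨0, le_rfl, fun d W x0 => ?_⟩
    rw [featVar_zero_fun d hL, hσ]
    simp
  · have hpos : 0 < Real.sqrt (sigmaC φ L) :=
      Real.sqrt_pos.2 (lt_of_le_of_ne (sigmaC_nonneg φ L) (Ne.symm hσ))
    refine ⟨(Real.sqrt (sigmaC φ L))⁻¹, by positivity, fun d W x0 => ?_⟩
    set q := featVar φ d W x0 L with hq
    have hq0 : 0 ≤ q := featVar_nonneg φ d W x0 L
    have h1 : q - sigmaC φ L = (Real.sqrt q - Real.sqrt (sigmaC φ L)) *
        (Real.sqrt q + Real.sqrt (sigmaC φ L)) := by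
      nlinarith [Real.sq_sqrt hq0, Real.sq_sqrt (sigmaC_nonneg φ L)]
    rw [h1, abs_mul, abs_of_nonneg (add_nonneg (Real.sqrt_nonneg q) hpos.le), inv_mul_eq_div,
      le_div_iff₀ hpos]
    exact mul_le_mul_of_nonneg_left (le_add_of_nonneg_left (Real.sqrt_nonneg q)) (abs_nonneg _)

lemma QuadLip.abs_integral_comp_mul_sub_le {F : ℝ → ℝ} {B : ℝ} (h : QuadLip F B) (a b : ℝ) :
    |(∫ z, F (a * z) ∂stdG) - ∫ z, F (b * z) ∂stdG| ≤
      B * (|a - b| * (1 + a ^ 2 + b ^ 2)) * ∫ z, (1 + z ^ 2) ^ 2 ∂stdG := by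
  have hi : ∀ c : ℝ, Integrable (fun z => F (c * z)) stdG := fun c =>
    h.integrable_comp (by fun_prop) (integrable_mul_pow_four_stdG c)
  rw [← integral_sub (hi a) (hi b), ← integral_const_mul]
  have hI : Integrable (fun z : ℝ => (1 + z ^ 2) ^ 2) stdG := by
    have e : (fun z : ℝ => (1 + z ^ 2) ^ 2) = fun z => 1 + 2 * z ^ 2 + z ^ 4 := by ext; ring
    rw [e]
    exact ((integrable_const _).add ((integrable_pow_stdG 2).const_mul 2)).add
      (integrable_pow_stdG 4)
  have hB := h.nonneg
  rw [← Real.norm_eq_abs]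
  refine norm_integral_le_of_norm_le
    (g := fun z : ℝ => B * (|a - b| * (1 + a ^ 2 + b ^ 2)) * (1 + z ^ 2) ^ 2)
    (hI.const_mul _) (.of_forall fun z => ?_)
  rw [Real.norm_eq_abs]
  refine (h _ _).trans ?_
  have e1 : |a * z - b * z| = |a - b| * |z| := by rw [← abs_mul]; congr 1; ring
  have e2 : |z| ≤ 1 + z ^ 2 := by
    rw [← sq_abs z]; nlinarith [sq_nonneg (|z| - 1), abs_nonneg z]
  have e3 : 1 + (a * z) ^ 2 + (b * z) ^ 2 ≤ (1 + a ^ 2 + b ^ 2) * (1 + z ^ 2) := by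
    nlinarith [sq_nonneg a, sq_nonneg b, sq_nonneg z]
  rw [e1]
  calc _ ≤ B * (|a - b| * (1 + z ^ 2)) * ((1 + a ^ 2 + b ^ 2) * (1 + z ^ 2)) := by gcongr
    _ = _ := by ring

lemma exists_netLaw_approx {φ : ℝ → ℝ} (hφ : Continuous φ) {K : ℝ}
    (hK : ∀ x y, |φ x - φ y| ≤ K * |x - y|) (h0 : φ 0 = 0) (L : ℕ) (ρ : ℝ) (hρ : 0 < ρ) :
    ∃ C : ℝ, 0 ≤ C ∧ ∀ d : ℕ → ℕ, (∀ ℓ ≤ L, 1 ≤ d ℓ) →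
      Integrable (fun t : ℝ => t ^ 4) (netLaw φ d L) ∧
      ∀ F B, QuadLip F B →
        |(∫ t, F (ρ * t) ∂(netLaw φ d L)) -
          ∫ z, F (z * Real.sqrt (ρ ^ 2 * sigmaC φ L)) ∂stdG| ≤
          B * (C / Real.sqrt (dmin d L : ℝ)) := by
  obtain ⟨C, hC, hCb⟩ := lintegral_featVar_deviation_le hφ hK h0 L
  obtain ⟨κ, hκ, hκb⟩ := exists_abs_sqrt_featVar_sub_le hφ hK h0 L
  set M := ∫ z, (1 + z ^ 2) ^ 2 ∂stdG with hM
  have hM0 : 0 ≤ M := integral_nonneg fun z => by positivity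
  set s := sigmaC φ L with hs
  have hs0 : 0 ≤ s := sigmaC_nonneg φ L
  set a := ρ * κ * (1 + 2 * ρ ^ 2 * s) * M with ha
  set b := ρ * κ * ρ ^ 2 * M with hb
  have ha0 : 0 ≤ a := by positivity
  have hb0 : 0 ≤ b := by positivity
  refine ⟨a * (C + 1) + b * C, by positivity, fun d hd => ?_⟩
  have hdmin : ∀ k ≤ L, dmin d L ≤ d k := fun k hk =>
    Finset.inf'_le _ (Finset.mem_range.2 (by omega))
  have hD1 : 1 ≤ dmin d L := by
    refine (Finset.le_inf'_iff _ _).2 fun k hk => hd k ?_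
    have := Finset.mem_range.1 hk
    omega
  set D : ℝ := (dmin d L : ℝ) with hD
  have hD1' : 1 ≤ D := Nat.one_le_cast.2 hD1
  have hD0 : 0 < D := by linarith
  have hlint := hCb L d D le_rfl hD0 hd fun k hk =>
    Nat.cast_le.2 (hdmin k hk)
  set μ := (stdGPi (d 0)).prod (Wmeasure d L) with hμ
  set v : (Fin (d 0) → ℝ) × Wspace d L → ℝ := fun q => featVar φ d (extW q.2) q.1 L with hv
  have hv0 : ∀ q, 0 ≤ v q := fun q => featVar_nonneg _ _ _ _ _
  have hvm : Measurable v := measurable_featVar hφ.measurable d L L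
  have hw2 : Integrable (fun q => (v q - s) ^ 2) μ := by
    refine ⟨(by fun_prop), ?_⟩
    rw [hasFiniteIntegral_iff_ofReal (.of_forall fun _ => sq_nonneg _)]
    exact hlint.trans_lt ENNReal.ofReal_lt_top
  have hw2le : ∫ q, (v q - s) ^ 2 ∂μ ≤ C / D := by
    rw [integral_eq_lintegral_of_nonneg_ae (.of_forall fun _ => sq_nonneg _) (by fun_prop)]
    exact ENNReal.toReal_le_of_le_ofReal (by positivity) hlint
  have hv2 : Integrable (fun q => v q ^ 2) μ := by
    refine ((hw2.const_mul 2).add (integrable_const (2 * s ^ 2))).mono' (by fun_prop)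
      (.of_forall fun q => ?_)
    rw [Real.norm_of_nonneg (sq_nonneg _)]
    simp only [Pi.add_apply]
    nlinarith [sq_nonneg (v q - 2 * s)]
  have hm : Measurable fun q : ((Fin (d 0) → ℝ) × Wspace d L) × ℝ =>
      Real.sqrt (v q.1) * q.2 :=
    (Real.continuous_sqrt.measurable.comp (hvm.comp measurable_fst)).mul measurable_snd
  have h4 : Integrable (fun q : ((Fin (d 0) → ℝ) × Wspace d L) × ℝ =>
      (Real.sqrt (v q.1) * q.2) ^ 4) (μ.prod stdG) := by
    refine (hv2.mul_prod (integrable_pow_stdG 4)).congr (.of_forall fun q => ?_)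
    simp only
    rw [mul_pow, show Real.sqrt (v q.1) ^ 4 = (Real.sqrt (v q.1) ^ 2) ^ 2 by ring,
      Real.sq_sqrt (hv0 _)]
  rw [netLaw_eq hφ.measurable]
  constructor
  · rw [integrable_map_measure (by fun_prop) hm.aemeasurable]
    exact h4
  intro F B hF
  have hB := hF.nonneg
  have hFi : Integrable (fun q : ((Fin (d 0) → ℝ) × Wspace d L) × ℝ =>
      F (ρ * (Real.sqrt (v q.1) * q.2))) (μ.prod stdG) :=
    hF.integrable_comp (by fun_prop) (by simpa only [mul_pow ρ] using h4.const_mul (ρ ^ 4))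
  have hFc := hF.continuous
  rw [integral_map hm.aemeasurable (by fun_prop)]
  rw [integral_prod _ hFi]
  set T := ∫ z, F (z * Real.sqrt (ρ ^ 2 * s)) ∂stdG with hT
  have hsub : (∫ q, ∫ z, F (ρ * (Real.sqrt (v q) * z)) ∂stdG ∂μ) - T =
      ∫ q, ((∫ z, F (ρ * (Real.sqrt (v q) * z)) ∂stdG) - T) ∂μ := by
    rw [integral_sub hFi.integral_prod_left (integrable_const _)]
    simp
  rw [hsub]
  have hT' : T = ∫ z, F (ρ * Real.sqrt s * z) ∂stdG := by
    rw [hT, Real.sqrt_mul (sq_nonneg ρ), Real.sqrt_sq hρ.le]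
    simp only [mul_comm]
  have hsD : 0 < Real.sqrt D := Real.sqrt_pos.2 hD0
  have hsD1 : 1 ≤ Real.sqrt D := Real.one_le_sqrt.2 hD1'
  have hpt : ∀ q, ‖(∫ z, F (ρ * (Real.sqrt (v q) * z)) ∂stdG) - T‖ ≤
      B * ((a * Real.sqrt D + b) * (v q - s) ^ 2 + a / Real.sqrt D) := by
    intro q
    have hq := hF.abs_integral_comp_mul_sub_le (ρ * Real.sqrt (v q)) (ρ * Real.sqrt s)
    simp only [← mul_assoc]
    rw [Real.norm_eq_abs, hT']
    refine hq.trans ?_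
    have k1 : |ρ * Real.sqrt (v q) - ρ * Real.sqrt s| ≤ ρ * (κ * |v q - s|) := by
      rw [← mul_sub, abs_mul, abs_of_pos hρ]
      exact mul_le_mul_of_nonneg_left (hκb d (extW q.2) q.1) hρ.le
    have k2 : 1 + (ρ * Real.sqrt (v q)) ^ 2 + (ρ * Real.sqrt s) ^ 2 ≤
        1 + 2 * ρ ^ 2 * s + ρ ^ 2 * |v q - s| := by
      rw [mul_pow, mul_pow, Real.sq_sqrt (hv0 q), Real.sq_sqrt hs0]
      nlinarith [mul_le_mul_of_nonneg_left (le_abs_self (v q - s)) (sq_nonneg ρ)]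
    have k3 : |v q - s| ≤ Real.sqrt D * (v q - s) ^ 2 + 1 / Real.sqrt D := by
      rw [← sq_abs (v q - s)]
      have e : Real.sqrt D * |v q - s| ^ 2 + 1 / Real.sqrt D - |v q - s| =
          ((Real.sqrt D * |v q - s| - 1 / 2) ^ 2 + 3 / 4) / Real.sqrt D := by
        field_simp
        ring
      have : 0 ≤ ((Real.sqrt D * |v q - s| - 1 / 2) ^ 2 + 3 / 4) / Real.sqrt D := by positivity
      linarith
    rw [mul_assoc B]
    refine mul_le_mul_of_nonneg_left ?_ hB
    calc _ ≤ ρ * (κ * |v q - s|) * (1 + 2 * ρ ^ 2 * s + ρ ^ 2 * |v q - s|) * M := by gcongr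
      _ = a * |v q - s| + b * (v q - s) ^ 2 := by
        rw [ha, hb, ← sq_abs (v q - s)]; ring
      _ ≤ a * (Real.sqrt D * (v q - s) ^ 2 + 1 / Real.sqrt D) + b * (v q - s) ^ 2 := by gcongr
      _ = _ := by ring
  have hI : Integrable (fun q => B * ((a * Real.sqrt D + b) * (v q - s) ^ 2 + a / Real.sqrt D))
      μ := ((hw2.const_mul _).add (integrable_const _)).const_mul _
  refine (norm_integral_le_of_norm_le hI (.of_forall hpt)).trans ?_
  rw [integral_const_mul, integral_add (hw2.const_mul _) (integrable_const _), integral_const_mul]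
  simp only [integral_const, probReal_univ, smul_eq_mul, one_mul]
  refine mul_le_mul_of_nonneg_left ?_ hB
  have e1 : (a * Real.sqrt D + b) * (C / D) ≤ (a * C + b * C) / Real.sqrt D := by
    have hDD : D = Real.sqrt D * Real.sqrt D := (Real.mul_self_sqrt hD0.le).symm
    have : (a * Real.sqrt D + b) * (C / D) = (a * C + b * C / Real.sqrt D) / Real.sqrt D := by
      conv_lhs => rw [hDD]
      rw [Real.sqrt_mul_self hsD.le]
      field_simp
    rw [this]
    gcongr
    exact div_le_self (by positivity) hsD1
  calc _ ≤ (a * Real.sqrt D + b) * (C / D) + a / Real.sqrt D := by gcongr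
    _ ≤ (a * C + b * C) / Real.sqrt D + a / Real.sqrt D := by gcongr
    _ = _ := by ring

/-- Stability of a Gaussian free energy under a bounded perturbation of the residual. -/
lemma log_integral_exp_neg_sq_le {Ω : Type*} [MeasurableSpace Ω] {μ : Measure Ω}
    [IsProbabilityMeasure μ] {u u' : Ω → ℝ} (hu : Measurable u) (hu' : Measurable u')
    {Δ δ m : ℝ} (hΔ : 0 < Δ) (hδ : ∀ ω, |u ω - u' ω| ≤ δ) (hi : Integrable (fun ω => u ω ^ 2) μ)
    (hm : ∫ ω, u ω ^ 2 ∂μ ≤ m) :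
    Real.log (∫ ω, Real.exp (-(u ω) ^ 2 / (2 * Δ)) ∂μ) ≤
      Real.log (∫ ω, Real.exp (-(u' ω) ^ 2 / (2 * Δ)) ∂μ) + δ * (1 + m + δ) / (2 * Δ) := by
  have hexp : ∀ v : Ω → ℝ, Measurable v →
      Integrable (fun ω => Real.exp (-(v ω) ^ 2 / (2 * Δ))) μ := by
    intro v hv
    refine (integrable_const (1 : ℝ)).mono' (by fun_prop) (.of_forall fun ω => ?_)
    rw [Real.norm_of_nonneg (Real.exp_pos _).le, Real.exp_le_one_iff]
    exact div_nonpos_of_nonpos_of_nonneg (by nlinarith [sq_nonneg (v ω)]) (by positivity)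
  obtain ⟨ω₀⟩ : Nonempty Ω := μ.nonempty_of_neZero
  have hδ0 : 0 ≤ δ := (abs_nonneg _).trans (hδ ω₀)
  set c := δ * (1 + m + δ) / (2 * Δ) with hc
  have hpt : ∀ ω, Real.exp (-c) * (Real.exp (-(u ω) ^ 2 / (2 * Δ)) +
      δ / (2 * Δ) * Real.exp (-m / (2 * Δ)) * (m - u ω ^ 2)) ≤
      Real.exp (-(u' ω) ^ 2 / (2 * Δ)) := by
    intro ω
    have h1 : u' ω ^ 2 - u ω ^ 2 ≤ δ * (1 + u ω ^ 2 + δ) := by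
      have hd := abs_le.1 (hδ ω)
      have h2 : |u' ω - u ω| ≤ δ := by rw [abs_sub_comm]; exact hδ ω
      have h3 : |u' ω + u ω| ≤ 1 + u ω ^ 2 + δ := by
        have : u' ω + u ω = 2 * u ω + (u' ω - u ω) := by ring
        rw [this]
        refine (abs_add_le _ _).trans (add_le_add (abs_le.2 ⟨?_, ?_⟩) h2)
        · nlinarith [sq_nonneg (u ω + 1)]
        · nlinarith [sq_nonneg (u ω - 1)]
      calc u' ω ^ 2 - u ω ^ 2 = (u' ω - u ω) * (u' ω + u ω) := by ring
        _ ≤ |u' ω - u ω| * |u' ω + u ω| := by rw [← abs_mul]; exact le_abs_self _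
        _ ≤ _ := by gcongr
    have h4 : 1 + δ / (2 * Δ) * (m - u ω ^ 2) ≤
        Real.exp (c + (u ω ^ 2 - u' ω ^ 2) / (2 * Δ)) := by
      refine le_trans ?_ (Real.add_one_le_exp _)
      have : δ / (2 * Δ) * (m - u ω ^ 2) ≤ c + (u ω ^ 2 - u' ω ^ 2) / (2 * Δ) := by
        rw [hc, ← add_div, div_mul_eq_mul_div]
        refine div_le_div_of_nonneg_right ?_ (by positivity)
        nlinarith
      linarith
    have h5 : Real.exp (-m / (2 * Δ)) * (m - u ω ^ 2) ≤
        Real.exp (-(u ω) ^ 2 / (2 * Δ)) * (m - u ω ^ 2) := by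
      rcases le_total (u ω ^ 2) m with h | h
      · refine mul_le_mul_of_nonneg_right (Real.exp_le_exp.2 ?_) (by linarith)
        exact div_le_div_of_nonneg_right (by linarith) (by positivity)
      · refine mul_le_mul_of_nonpos_right (Real.exp_le_exp.2 ?_) (by linarith)
        exact div_le_div_of_nonneg_right (by linarith) (by positivity)
    have h6 : Real.exp (-(u' ω) ^ 2 / (2 * Δ)) = Real.exp (-c) *
        (Real.exp (-(u ω) ^ 2 / (2 * Δ)) *
          Real.exp (c + (u ω ^ 2 - u' ω ^ 2) / (2 * Δ))) := by
      rw [← Real.exp_add, ← Real.exp_add]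
      congr 1
      ring
    rw [h6]
    refine mul_le_mul_of_nonneg_left ?_ (Real.exp_pos _).le
    have h7 := mul_le_mul_of_nonneg_left h4 (Real.exp_pos (-(u ω) ^ 2 / (2 * Δ))).le
    have h8 := mul_le_mul_of_nonneg_left h5 (show 0 ≤ δ / (2 * Δ) by positivity)
    nlinarith
  have hint : Real.exp (-c) * ∫ ω, Real.exp (-(u ω) ^ 2 / (2 * Δ)) ∂μ ≤
      ∫ ω, Real.exp (-(u' ω) ^ 2 / (2 * Δ)) ∂μ := by
    have hl : Integrable (fun ω => δ / (2 * Δ) * Real.exp (-m / (2 * Δ)) * (m - u ω ^ 2)) μ :=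
      ((integrable_const m).sub hi).const_mul _
    have h := integral_mono (((hexp u hu).add hl).const_mul (Real.exp (-c))) (hexp u' hu') hpt
    refine le_trans ?_ h
    rw [integral_const_mul]
    simp only [Pi.add_apply]
    rw [integral_add (hexp u hu) hl, integral_const_mul, integral_sub (integrable_const _) hi]
    simp only [integral_const, probReal_univ, smul_eq_mul, one_mul]
    refine mul_le_mul_of_nonneg_left (le_add_of_nonneg_right ?_) (Real.exp_pos _).le
    exact mul_nonneg (by positivity) (by linarith)
  have hpos := integral_exp_pos (hexp u hu)
  have hlog := Real.log_le_log (by positivity) hint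
  rw [Real.log_mul (Real.exp_pos _).ne' hpos.ne', Real.log_exp] at hlog
  linarith

/-- Local Lipschitz bound with quadratically growing constant, in two variables. -/
def QuadLip₂ (h : ℝ → ℝ → ℝ) (C : ℝ) : Prop :=
  ∀ y s y' s', |h y s - h y' s'| ≤
    C * (|y - y'| + |s - s'|) * (1 + y ^ 2 + y' ^ 2 + s ^ 2 + s' ^ 2)

lemma QuadLip₂.nonneg {h : ℝ → ℝ → ℝ} {C : ℝ} (hh : QuadLip₂ h C) : 0 ≤ C := by
  have := (abs_nonneg _).trans (hh 1 0 0 0)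
  norm_num at this
  linarith

lemma QuadLip₂.continuous {h : ℝ → ℝ → ℝ} {C : ℝ} (hh : QuadLip₂ h C) :
    Continuous (Function.uncurry h) := by
  refine continuous_iff_continuousAt.2 fun t => ?_
  rw [ContinuousAt, tendsto_iff_norm_sub_tendsto_zero]
  refine squeeze_zero (fun _ => norm_nonneg _) (fun t' => hh t'.1 t'.2 t.1 t.2) ?_
  have : Continuous fun t' : ℝ × ℝ => C * (|t'.1 - t.1| + |t'.2 - t.2|) *
    (1 + t'.1 ^ 2 + t.1 ^ 2 + t'.2 ^ 2 + t.2 ^ 2) := by fun_prop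
  simpa using this.tendsto t

lemma QuadLip₂.abs_le {h : ℝ → ℝ → ℝ} {C : ℝ} (hh : QuadLip₂ h C) (y s : ℝ) :
    |h y s| ≤ |h 0 0| + C * (3 * (1 + y ^ 4 + s ^ 4)) := by
  have h1 := hh y s 0 0
  have h2 : |h y s| ≤ |h 0 0| + |h y s - h 0 0| := by
    simpa using abs_add_le (h 0 0) (h y s - h 0 0)
  have h3 : (|y| + |s|) * (1 + y ^ 2 + s ^ 2) ≤ 3 * (1 + y ^ 4 + s ^ 4) := by
    have a1 : |y| + |s| ≤ 1 + y ^ 2 + s ^ 2 := by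
      rw [← sq_abs y, ← sq_abs s]
      nlinarith [sq_nonneg (|y| - 1), sq_nonneg (|s| - 1), abs_nonneg y, abs_nonneg s]
    calc _ ≤ (1 + y ^ 2 + s ^ 2) * (1 + y ^ 2 + s ^ 2) := by gcongr
      _ ≤ _ := by
        nlinarith [sq_nonneg (y ^ 2 - 1), sq_nonneg (s ^ 2 - 1), sq_nonneg (y ^ 2 - s ^ 2)]
  have h4 := mul_le_mul_of_nonneg_left h3 hh.nonneg
  simp only [sub_zero] at h1
  nlinarith

lemma QuadLip₂.integrable_comp {h : ℝ → ℝ → ℝ} {C : ℝ} (hh : QuadLip₂ h C) {Ω : Type*}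
    [MeasurableSpace Ω] {μ : Measure Ω} [IsFiniteMeasure μ] {Y S : Ω → ℝ}
    (hY : MemLp Y 4 μ) (hS : MemLp S 4 μ) : Integrable (fun ω => h (Y ω) (S ω)) μ := by
  have h4 : ∀ {X : Ω → ℝ}, MemLp X 4 μ → Integrable (fun ω => X ω ^ 4) μ := by
    intro X hX
    have := hX.integrable_norm_pow (p := 4) (by norm_num)
    simpa [Even.pow_abs (show Even 4 by decide)] using this
  refine ((integrable_const |h 0 0|).add ((((integrable_const 1).add (h4 hY)).add
    (h4 hS)).const_mul 3 |>.const_mul C)).mono' ?_ (.of_forall fun ω => hh.abs_le _ _)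
  exact hh.continuous.comp_aestronglyMeasurable₂ hY.aestronglyMeasurable hS.aestronglyMeasurable

lemma measurable_channel_comp {p : ℕ} {f : ℝ → (Fin p → ℝ) → ℝ} (hf : Measurable (Function.uncurry f))
    {Ω : Type*} [MeasurableSpace Ω] {X : Ω → ℝ} {A : Ω → Fin p → ℝ} (hX : Measurable X)
    (hA : Measurable A) : Measurable fun ω => f (X ω) (A ω) :=
  hf.comp (hX.prodMk hA)

/-- The logarithm of the smeared channel is locally Lipschitz. -/
lemma exists_quadLip₂_log_PoutEps {p : ℕ} (PA : Measure (Fin p → ℝ)) [IsProbabilityMeasure PA]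
    {Δ ε K : ℝ} (hΔ : 0 < Δ) (hε : 0 ≤ ε) {f : ℝ → (Fin p → ℝ) → ℝ}
    (hf : Measurable (Function.uncurry f)) (hK : ∀ A x y, |f x A - f y A| ≤ K * |x - y|)
    (hf0 : ∀ A, f 0 A = 0) :
    ∃ C, QuadLip₂ (fun y s => Real.log (PoutEps PA Δ f ε y s)) C := by
  have hK0 : 0 ≤ K := by
    have := (abs_nonneg _).trans (hK 0 1 0)
    simpa using this
  set μ := stdG.prod PA with hμ
  set u : ℝ → ℝ → ℝ × (Fin p → ℝ) → ℝ := fun y s r => y - f (s + Real.sqrt ε * r.1) r.2 with hu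
  have hum : ∀ y s, Measurable (u y s) := fun y s =>
    measurable_const.sub (measurable_channel_comp hf (by fun_prop) measurable_snd)
  have hexp : ∀ y s, Integrable (fun r => Real.exp (-(u y s r) ^ 2 / (2 * Δ))) μ := by
    intro y s
    have := hum y s
    refine (integrable_const (1 : ℝ)).mono' (by fun_prop) (.of_forall fun ω => ?_)
    rw [Real.norm_of_nonneg (Real.exp_pos _).le, Real.exp_le_one_iff]
    exact div_nonpos_of_nonpos_of_nonneg (by nlinarith [sq_nonneg (u y s ω)]) (by positivity)
  have hlog : ∀ y s, Real.log (PoutEps PA Δ f ε y s) =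
      Real.log (∫ r, Real.exp (-(u y s r) ^ 2 / (2 * Δ)) ∂μ) -
        Real.log (Real.sqrt (2 * Real.pi * Δ)) := by
    intro y s
    have : PoutEps PA Δ f ε y s = (∫ r, Real.exp (-(u y s r) ^ 2 / (2 * Δ)) ∂μ) /
        Real.sqrt (2 * Real.pi * Δ) := by
      rw [integral_prod _ (hexp y s), ← integral_div]
      simp only [← integral_div]
      rfl
    rw [this, Real.log_div (integral_exp_pos (hexp y s)).ne' (by positivity)]
  have hu2 : ∀ y s r, u y s r ^ 2 ≤ 3 * (y ^ 2 + K ^ 2 * s ^ 2) + 3 * K ^ 2 * ε * r.1 ^ 2 := by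
    intro y s r
    have h1 : |f (s + Real.sqrt ε * r.1) r.2| ≤ K * (|s| + Real.sqrt ε * |r.1|) := by
      have := hK r.2 (s + Real.sqrt ε * r.1) 0
      rw [hf0, sub_zero, sub_zero] at this
      refine this.trans (mul_le_mul_of_nonneg_left ((abs_add_le _ _).trans ?_) hK0)
      rw [abs_mul, abs_of_nonneg (Real.sqrt_nonneg ε)]
    have h2 : |u y s r| ≤ |y| + K * |s| + K * (Real.sqrt ε * |r.1|) := by
      have := abs_sub y (f (s + Real.sqrt ε * r.1) r.2)
      simp only [hu]
      linarith
    have h3 : u y s r ^ 2 ≤ (|y| + K * |s| + K * (Real.sqrt ε * |r.1|)) ^ 2 := by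
      rw [← sq_abs]
      exact pow_le_pow_left₀ (abs_nonneg _) h2 2
    refine h3.trans ?_
    rw [← sq_abs y, ← sq_abs s, ← sq_abs r.1]
    have h4 := Real.sq_sqrt hε
    have h5 : 3 * K ^ 2 * ε * |r.1| ^ 2 = 3 * (K * (Real.sqrt ε * |r.1|)) ^ 2 := by
      rw [mul_pow, mul_pow, h4]; ring
    rw [h5]
    nlinarith [sq_nonneg (|y| - K * |s|), sq_nonneg (|y| - K * (Real.sqrt ε * |r.1|)),
      sq_nonneg (K * |s| - K * (Real.sqrt ε * |r.1|))]
  have hξ : Integrable (fun r : ℝ × (Fin p → ℝ) => r.1 ^ 2) μ :=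
    (integrable_pow_stdG 2).comp_fst PA
  have hξi : ∫ r, r.1 ^ 2 ∂μ = 1 := by
    rw [hμ, integral_fun_fst (fun x : ℝ => x ^ 2)]
    simp [integral_sq_stdG]
  have hdom : ∀ y s, Integrable (fun r : ℝ × (Fin p → ℝ) =>
      3 * (y ^ 2 + K ^ 2 * s ^ 2) + 3 * K ^ 2 * ε * r.1 ^ 2) μ := fun y s =>
    (integrable_const _).add (hξ.const_mul _)
  have hui : ∀ y s, Integrable (fun r => u y s r ^ 2) μ := by
    intro y s
    refine (hdom y s).mono' ((hum y s).pow_const 2).aestronglyMeasurable (.of_forall fun r => ?_)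
    rw [Real.norm_of_nonneg (sq_nonneg _)]
    exact hu2 y s r
  have hum2 : ∀ y s, ∫ r, u y s r ^ 2 ∂μ ≤ 3 * (y ^ 2 + K ^ 2 * s ^ 2) + 3 * K ^ 2 * ε := by
    intro y s
    refine (integral_mono (hui y s) (hdom y s) (hu2 y s)).trans (le_of_eq ?_)
    rw [integral_add (integrable_const _) (hξ.const_mul _),
      integral_const_mul (3 * K ^ 2 * ε), hξi]
    simp
  have hone : ∀ y s y' s', Real.log (PoutEps PA Δ f ε y s) - Real.log (PoutEps PA Δ f ε y' s') ≤
      ((1 + K) * (4 * (1 + K ^ 2) * (1 + ε)) / (2 * Δ)) *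
        (|y - y'| + |s - s'|) * (1 + y ^ 2 + y' ^ 2 + s ^ 2 + s' ^ 2) := by
    intro y s y' s'
    have hδ : ∀ r, |u y s r - u y' s' r| ≤ |y - y'| + K * |s - s'| := by
      intro r
      have e : u y s r - u y' s' r = (y - y') -
        (f (s + Real.sqrt ε * r.1) r.2 - f (s' + Real.sqrt ε * r.1) r.2) := by
        simp only [hu]; ring
      rw [e]
      refine (abs_sub _ _).trans (add_le_add le_rfl ((hK _ _ _).trans (le_of_eq ?_)))
      congr 2
      ring
    have hmain := log_integral_exp_neg_sq_le (hum y s) (hum y' s') hΔ hδ (hui y s) (hum2 y s)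
    rw [hlog, hlog]
    have hδ' : |y - y'| + K * |s - s'| ≤ 2 + (y ^ 2 + y' ^ 2 + K ^ 2 * s ^ 2 + K ^ 2 * s' ^ 2) := by
      have a1 := abs_sub y y'
      have a2 := mul_le_mul_of_nonneg_left (abs_sub s s') hK0
      rw [← sq_abs y, ← sq_abs y', ← sq_abs s, ← sq_abs s']
      nlinarith [sq_nonneg (|y| - 1 / 2), sq_nonneg (|y'| - 1 / 2),
        sq_nonneg (K * |s| - 1 / 2), sq_nonneg (K * |s'| - 1 / 2)]
    have hδ'' : |y - y'| + K * |s - s'| ≤ (1 + K) * (|y - y'| + |s - s'|) := by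
      nlinarith [abs_nonneg (y - y'), abs_nonneg (s - s'),
        mul_nonneg hK0 (abs_nonneg (y - y'))]
    have hQ : 1 + (3 * (y ^ 2 + K ^ 2 * s ^ 2) + 3 * K ^ 2 * ε) + (|y - y'| + K * |s - s'|) ≤
        4 * (1 + K ^ 2) * (1 + ε) * (1 + y ^ 2 + y' ^ 2 + s ^ 2 + s' ^ 2) := by
      have b1 : 3 + 3 * K ^ 2 * ε + 4 * (y ^ 2 + y' ^ 2 + K ^ 2 * s ^ 2 + K ^ 2 * s' ^ 2) ≤
          4 * (1 + K ^ 2) * (1 + ε) * (1 + y ^ 2 + y' ^ 2 + s ^ 2 + s' ^ 2) := by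
        have c1 : 0 ≤ K ^ 2 * ε := by positivity
        have c2 : 0 ≤ (1 + K ^ 2) * ε * (y ^ 2 + y' ^ 2 + s ^ 2 + s' ^ 2) := by positivity
        have c3 : 0 ≤ K ^ 2 * (y ^ 2 + y' ^ 2) := by positivity
        nlinarith [sq_nonneg s, sq_nonneg s', sq_nonneg K]
      have b2 : 0 ≤ K ^ 2 * s' ^ 2 := by positivity
      nlinarith [sq_nonneg y, sq_nonneg y', sq_nonneg (K * s)]
    have hfin : (|y - y'| + K * |s - s'|) *
        (1 + (3 * (y ^ 2 + K ^ 2 * s ^ 2) + 3 * K ^ 2 * ε) + (|y - y'| + K * |s - s'|)) /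
          (2 * Δ) ≤
        ((1 + K) * (|y - y'| + |s - s'|)) *
          (4 * (1 + K ^ 2) * (1 + ε) * (1 + y ^ 2 + y' ^ 2 + s ^ 2 + s' ^ 2)) / (2 * Δ) := by
      gcongr
    have e : ((1 + K) * (|y - y'| + |s - s'|)) *
          (4 * (1 + K ^ 2) * (1 + ε) * (1 + y ^ 2 + y' ^ 2 + s ^ 2 + s' ^ 2)) / (2 * Δ) =
        ((1 + K) * (4 * (1 + K ^ 2) * (1 + ε)) / (2 * Δ)) *
        (|y - y'| + |s - s'|) * (1 + y ^ 2 + y' ^ 2 + s ^ 2 + s' ^ 2) := by ring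
    rw [e] at hfin
    linarith
  refine ⟨_, fun y s y' s' => abs_le.2 ⟨?_, hone y s y' s'⟩⟩
  have := hone y' s' y s
  rw [abs_sub_comm y' y, abs_sub_comm s' s] at this
  have e : (1 + y' ^ 2 + y ^ 2 + s' ^ 2 + s ^ 2) = 1 + y ^ 2 + y' ^ 2 + s ^ 2 + s' ^ 2 := by ring
  rw [e] at this
  linarith

lemma PoutEps_zero {p : ℕ} (PA : Measure (Fin p → ℝ)) (Δ : ℝ) (f : ℝ → (Fin p → ℝ) → ℝ) (y s : ℝ) :
    PoutEps PA Δ f 0 y s = Pout PA Δ f y s := by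
  simp [PoutEps]

lemma memLp_lipschitz_channel_comp {p : ℕ} {f : ℝ → (Fin p → ℝ) → ℝ} {K : ℝ}
    (hf : Measurable (Function.uncurry f)) (hK : ∀ A x y, |f x A - f y A| ≤ K * |x - y|)
    (hf0 : ∀ A, f 0 A = 0) {Ω : Type*} [MeasurableSpace Ω] {μ : Measure Ω} {X : Ω → ℝ}
    {A : Ω → Fin p → ℝ} (hX : Measurable X) (hA : Measurable A) {q : ENNReal}
    (hXq : MemLp X q μ) : MemLp (fun ω => f (X ω) (A ω)) q μ := by
  refine (hXq.norm.const_mul K).mono' (measurable_channel_comp hf hX hA).aestronglyMeasurable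
    (.of_forall fun ω => ?_)
  simpa [hf0] using hK (A ω) (X ω) 0

lemma map_add_sqrt_mul_stdG (m : ℝ) {Δ : ℝ} (hΔ : 0 < Δ) :
    stdG.map (fun z => m + Real.sqrt Δ * z) = gaussianReal m Δ.toNNReal := by
  have h1 : (fun z => m + Real.sqrt Δ * z) = (fun z => m + z) ∘ (fun z => Real.sqrt Δ * z) := rfl
  rw [h1, ← Measure.map_map (by fun_prop) (by fun_prop), stdG, gaussianReal_map_const_mul,
    gaussianReal_map_const_add]
  congr 1
  · simp
  · ext
    simp [Real.sq_sqrt hΔ.le, hΔ.le]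

lemma integral_gaussian_channel (m : ℝ) {Δ : ℝ} (hΔ : 0 < Δ) {h : ℝ → ℝ} (hh : Measurable h) :
    ∫ z, h (m + Real.sqrt Δ * z) ∂stdG =
      ∫ y, Real.exp (-(y - m) ^ 2 / (2 * Δ)) / Real.sqrt (2 * Real.pi * Δ) * h y := by
  have hv : Δ.toNNReal ≠ 0 := by simpa using hΔ
  rw [← integral_map (φ := fun z => m + Real.sqrt Δ * z) (f := h) (by fun_prop)
    hh.aestronglyMeasurable, map_add_sqrt_mul_stdG m hΔ, integral_gaussianReal_eq_integral_smul hv]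
  refine integral_congr_ae (.of_forall fun y => ?_)
  simp only [gaussianPDFReal_def, smul_eq_mul, Real.coe_toNNReal _ hΔ.le]
  ring

lemma integrable_gaussian_channel_iff (m : ℝ) {Δ : ℝ} (hΔ : 0 < Δ) {h : ℝ → ℝ}
    (hh : Measurable h) :
    Integrable (fun z => h (m + Real.sqrt Δ * z)) stdG ↔
      Integrable fun y =>
        Real.exp (-(y - m) ^ 2 / (2 * Δ)) / Real.sqrt (2 * Real.pi * Δ) * h y := by
  have hv : Δ.toNNReal ≠ 0 := by simpa using hΔ
  have h1 : Integrable (fun z => h (m + Real.sqrt Δ * z)) stdG ↔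
      Integrable h (gaussianReal m Δ.toNNReal) := by
    rw [← map_add_sqrt_mul_stdG m hΔ]
    exact (integrable_map_measure hh.aestronglyMeasurable (by fun_prop)).symm
  rw [h1, gaussianReal_of_var_ne_zero _ hv, integrable_withDensity_iff_integrable_smul₀'
    (measurable_gaussianPDF _ _).aemeasurable (.of_forall fun _ => gaussianPDF_lt_top)]
  refine integrable_congr (.of_forall fun y => ?_)
  simp only [toReal_gaussianPDF, gaussianPDFReal_def, smul_eq_mul, Real.coe_toNNReal _ hΔ.le]
  ring

lemma integrable_density_mul {Ω : Type*} [MeasurableSpace Ω] {ν : Measure Ω} [SFinite ν]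
    {Δ : ℝ} (hΔ : 0 < Δ) {m c : Ω → ℝ} (hm : Measurable m) (hc : Measurable c) {h : ℝ → ℝ → ℝ}
    (hh : Measurable (Function.uncurry h))
    (hi : Integrable (fun q : Ω × ℝ => h (m q.1 + Real.sqrt Δ * q.2) (c q.1)) (ν.prod stdG)) :
    Integrable (Function.uncurry fun (q : Ω) (y : ℝ) =>
      Real.exp (-(y - m q) ^ 2 / (2 * Δ)) / Real.sqrt (2 * Real.pi * Δ) * h y (c q))
      (ν.prod volume) := by
  have hhm : ∀ a, Measurable fun y => h y a := fun a => hh.comp measurable_prodMk_right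
  have h1 : Measurable fun q : Ω × ℝ => h q.2 (c q.1) :=
    hh.comp (measurable_snd.prodMk (hc.comp measurable_fst))
  have h2 : Measurable fun q : Ω × ℝ => m q.1 := hm.comp measurable_fst
  have h3 : Measurable fun q : Ω × ℝ =>
      Real.exp (-(q.2 - m q.1) ^ 2 / (2 * Δ)) / Real.sqrt (2 * Real.pi * Δ) := by fun_prop
  refine (integrable_prod_iff (h3.mul h1).aestronglyMeasurable).2 ⟨?_, ?_⟩
  · filter_upwards [hi.prod_right_ae] with q hq
    exact (integrable_gaussian_channel_iff (h := fun y => h y (c q)) (m q) hΔ (hhm (c q))).1 hq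
  · refine hi.abs.integral_prod_left.congr (.of_forall fun q => ?_)
    refine (integral_gaussian_channel (h := fun y => |h y (c q)|) (m q) hΔ (hhm _).abs).trans ?_
    refine integral_congr_ae (.of_forall fun y => ?_)
    simp only [Real.norm_eq_abs, Pi.mul_apply, abs_mul, abs_div, Real.abs_exp,
      abs_of_nonneg (Real.sqrt_nonneg _)]

/-- Integrating against the channel density amounts to sampling the response. -/
lemma integral_Pout_mul {p : ℕ} (PA : Measure (Fin p → ℝ)) [IsProbabilityMeasure PA]
    {Δ K C : ℝ} (hΔ : 0 < Δ) {f : ℝ → (Fin p → ℝ) → ℝ} (hf : Measurable (Function.uncurry f))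
    (hK : ∀ A x y, |f x A - f y A| ≤ K * |x - y|) (hf0 : ∀ A, f 0 A = 0)
    {h : ℝ → ℝ → ℝ} (hh : QuadLip₂ h C) {Γ : Type*} [MeasurableSpace Γ] (γ : Measure Γ)
    [IsProbabilityMeasure γ] {x s : Γ → ℝ} (hx : Measurable x) (hs : Measurable s)
    (hx4 : MemLp x 4 γ) (hs4 : MemLp s 4 γ) :
    ∫ y, ∫ g, Pout PA Δ f y (x g) * h y (s g) ∂γ =
      ∫ g, ∫ r, h (f (x g) r.1 + Real.sqrt Δ * r.2) (s g) ∂(PA.prod stdG) ∂γ := by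
  have hz : MemLp (fun z : ℝ => z) 4 stdG := by
    exact memLp_id_stdG 4 (by simp)
  set k : (Γ × (Fin p → ℝ)) → ℝ → ℝ := fun q y =>
    Real.exp (-(y - f (x q.1) q.2) ^ 2 / (2 * Δ)) / Real.sqrt (2 * Real.pi * Δ) * h y (s q.1)
    with hk
  have hfm : Measurable fun q : Γ × (Fin p → ℝ) => f (x q.1) q.2 :=
    measurable_channel_comp hf (hx.comp measurable_fst) measurable_snd
  have hhm : ∀ c, Measurable fun y => h y c := fun c =>
    (hh.continuous.comp (by fun_prop : Continuous fun y : ℝ => (y, c))).measurable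
  have hbig : Integrable (fun q : (Γ × (Fin p → ℝ)) × ℝ =>
      h (f (x q.1.1) q.1.2 + Real.sqrt Δ * q.2) (s q.1.1)) ((γ.prod PA).prod stdG) := by
    refine hh.integrable_comp (MemLp.add ?_ ?_) ?_
    · refine (memLp_lipschitz_channel_comp hf hK hf0 (hx.comp measurable_fst) measurable_snd
        ((hx4.comp_fst PA))).comp_fst stdG
    · exact (hz.comp_snd (γ.prod PA)).const_mul _
    · exact (hs4.comp_fst PA).comp_fst stdG
  have hkint : Integrable (Function.uncurry k) ((γ.prod PA).prod volume) :=
    integrable_density_mul hΔ hfm (hs.comp measurable_fst) hh.continuous.measurable hbig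
  have hL : ∀ᵐ y, ∫ g, Pout PA Δ f y (x g) * h y (s g) ∂γ = ∫ q, k q y ∂(γ.prod PA) := by
    filter_upwards [hkint.prod_left_ae] with y hy
    refine Eq.trans ?_ (integral_prod _ hy).symm
    refine integral_congr_ae (.of_forall fun g => ?_)
    simp only [Pout, hk, Function.uncurry]
    exact (integral_mul_const _ _).symm
  rw [integral_congr_ae hL, ← integral_integral_swap hkint]
  have hR : ∀ q : Γ × (Fin p → ℝ), ∫ y, k q y =
      ∫ z, h (f (x q.1) q.2 + Real.sqrt Δ * z) (s q.1) ∂stdG := fun q =>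
    (integral_gaussian_channel (h := fun y => h y (s q.1)) _ hΔ (hhm _)).symm
  simp only [hR]
  rw [← integral_prod _ hbig]
  have hmp := (measurePreserving_prodAssoc γ PA stdG).symm
  rw [← hmp.integral_comp' , integral_prod]
  · rfl
  · exact (hmp.integrable_comp_emb (MeasurableEquiv.measurableEmbedding _)).2 hbig

/-- The observable `h` of the response and of the shifted signal, averaged over the output noise
at fixed network readout. -/
def chanAvg {p : ℕ} (PA : Measure (Fin p → ℝ)) (Δ ε b : ℝ) (f : ℝ → (Fin p → ℝ) → ℝ)
    (h : ℝ → ℝ → ℝ) (t : ℝ) : ℝ :=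
  ∫ r : ℝ × (Fin p → ℝ) × ℝ, h (f (t + Real.sqrt ε * r.1) r.2.1 + Real.sqrt Δ * r.2.2)
    (t + b * r.1) ∂(stdG.prod (PA.prod stdG))

lemma integrable_chanAvg {p : ℕ} (PA : Measure (Fin p → ℝ)) [IsProbabilityMeasure PA]
    {K C : ℝ} (Δ ε b : ℝ) {f : ℝ → (Fin p → ℝ) → ℝ} (hf : Measurable (Function.uncurry f))
    (hK : ∀ A x y, |f x A - f y A| ≤ K * |x - y|) (hf0 : ∀ A, f 0 A = 0) {h : ℝ → ℝ → ℝ}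
    (hh : QuadLip₂ h C) {Ω : Type*} [MeasurableSpace Ω] {μ : Measure Ω} [IsProbabilityMeasure μ]
    {X : Ω → ℝ} (hX : Measurable X) (hX4 : MemLp X 4 μ) :
    Integrable (fun q : Ω × ℝ × (Fin p → ℝ) × ℝ =>
      h (f (X q.1 + Real.sqrt ε * q.2.1) q.2.2.1 + Real.sqrt Δ * q.2.2.2) (X q.1 + b * q.2.1))
      (μ.prod (stdG.prod (PA.prod stdG))) := by
  have hz : MemLp (fun z : ℝ => z) 4 stdG := memLp_id_stdG 4 (by simp)
  have h1 : MemLp (fun q : Ω × ℝ × (Fin p → ℝ) × ℝ => X q.1) 4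
      (μ.prod (stdG.prod (PA.prod stdG))) := hX4.comp_fst _
  have h2 : MemLp (fun q : Ω × ℝ × (Fin p → ℝ) × ℝ => q.2.1) 4
      (μ.prod (stdG.prod (PA.prod stdG))) := (hz.comp_fst (PA.prod stdG)).comp_snd μ
  have h3 : MemLp (fun q : Ω × ℝ × (Fin p → ℝ) × ℝ => q.2.2.2) 4
      (μ.prod (stdG.prod (PA.prod stdG))) := ((hz.comp_snd PA).comp_snd stdG).comp_snd μ
  refine hh.integrable_comp (MemLp.add ?_ (h3.const_mul _)) (h1.add (h2.const_mul b))
  exact memLp_lipschitz_channel_comp hf hK hf0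
    ((hX.comp measurable_fst).add (by fun_prop)) (by fun_prop) (h1.add (h2.const_mul _))

lemma exists_quadLip_chanAvg {p : ℕ} (PA : Measure (Fin p → ℝ)) [IsProbabilityMeasure PA]
    {Δ ε K C : ℝ} (b : ℝ) (hΔ : 0 < Δ) (hε : 0 ≤ ε) {f : ℝ → (Fin p → ℝ) → ℝ}
    (hf : Measurable (Function.uncurry f)) (hK : ∀ A x y, |f x A - f y A| ≤ K * |x - y|)
    (hf0 : ∀ A, f 0 A = 0) {h : ℝ → ℝ → ℝ} (hh : QuadLip₂ h C) :
    ∃ B, QuadLip (chanAvg PA Δ ε b f h) B := by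
  have hK0 : 0 ≤ K := by
    have := (abs_nonneg _).trans (hK 0 1 0)
    simpa using this
  have hC := hh.nonneg
  set μ := stdG.prod (PA.prod stdG) with hμ
  have hi : ∀ t, Integrable (fun r : ℝ × (Fin p → ℝ) × ℝ =>
      h (f (t + Real.sqrt ε * r.1) r.2.1 + Real.sqrt Δ * r.2.2) (t + b * r.1)) μ := by
    intro t
    have := integrable_chanAvg PA Δ ε b hf hK hf0 hh (μ := (Measure.dirac () : Measure Unit))
      (X := fun _ => t) measurable_const (memLp_const t)
    rw [Measure.dirac_prod] at this
    exact this.comp_measurable measurable_prodMk_left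
  have hM : Integrable (fun r : ℝ × (Fin p → ℝ) × ℝ => 1 + r.1 ^ 2 + r.2.2 ^ 2) μ :=
    ((integrable_const _).add ((integrable_pow_stdG 2).comp_fst (PA.prod stdG))).add
      (((integrable_pow_stdG 2).comp_snd PA).comp_snd stdG)
  set E := 3 + 3 * K ^ 2 + 6 * K ^ 2 * ε + 4 * b ^ 2 + 6 * Δ with hE
  have hE0 : 0 ≤ E := by positivity
  refine ⟨C * (K + 1) * E * ∫ r, (1 + r.1 ^ 2 + r.2.2 ^ 2) ∂μ, fun t t' => ?_⟩
  have hsub : chanAvg PA Δ ε b f h t - chanAvg PA Δ ε b f h t' = ∫ r,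
      (h (f (t + Real.sqrt ε * r.1) r.2.1 + Real.sqrt Δ * r.2.2) (t + b * r.1) -
        h (f (t' + Real.sqrt ε * r.1) r.2.1 + Real.sqrt Δ * r.2.2) (t' + b * r.1)) ∂μ :=
    (integral_sub (hi t) (hi t')).symm
  have hsq : ∀ t (r : ℝ × (Fin p → ℝ) × ℝ),
      (f (t + Real.sqrt ε * r.1) r.2.1 + Real.sqrt Δ * r.2.2) ^ 2 ≤
        3 * K ^ 2 * t ^ 2 + 3 * K ^ 2 * ε * r.1 ^ 2 + 3 * Δ * r.2.2 ^ 2 := by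
    intro t r
    have a1 : |f (t + Real.sqrt ε * r.1) r.2.1| ≤ K * |t| + K * (Real.sqrt ε * |r.1|) := by
      have h1 := hK r.2.1 (t + Real.sqrt ε * r.1) 0
      rw [hf0, sub_zero, sub_zero] at h1
      have h2 := abs_add_le t (Real.sqrt ε * r.1)
      rw [abs_mul, abs_of_nonneg (Real.sqrt_nonneg ε)] at h2
      nlinarith
    have a2 : |f (t + Real.sqrt ε * r.1) r.2.1 + Real.sqrt Δ * r.2.2| ≤
        K * |t| + K * (Real.sqrt ε * |r.1|) + Real.sqrt Δ * |r.2.2| := by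
      refine (abs_add_le _ _).trans (add_le_add a1 ?_)
      rw [abs_mul, abs_of_nonneg (Real.sqrt_nonneg Δ)]
    have a3 := pow_le_pow_left₀ (abs_nonneg _) a2 2
    rw [sq_abs] at a3
    refine a3.trans ?_
    have e1 : 3 * K ^ 2 * ε * r.1 ^ 2 = 3 * (K * (Real.sqrt ε * |r.1|)) ^ 2 := by
      rw [mul_pow, mul_pow, Real.sq_sqrt hε, sq_abs]; ring
    have e2 : 3 * Δ * r.2.2 ^ 2 = 3 * (Real.sqrt Δ * |r.2.2|) ^ 2 := by
      rw [mul_pow, Real.sq_sqrt hΔ.le, sq_abs]; ring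
    have e3 : 3 * K ^ 2 * t ^ 2 = 3 * (K * |t|) ^ 2 := by
      rw [mul_pow, sq_abs]; ring
    rw [e1, e2, e3]
    nlinarith [sq_nonneg (K * |t| - K * (Real.sqrt ε * |r.1|)),
      sq_nonneg (K * |t| - Real.sqrt Δ * |r.2.2|),
      sq_nonneg (K * (Real.sqrt ε * |r.1|) - Real.sqrt Δ * |r.2.2|)]
  have hpt : ∀ r : ℝ × (Fin p → ℝ) × ℝ,
      ‖h (f (t + Real.sqrt ε * r.1) r.2.1 + Real.sqrt Δ * r.2.2) (t + b * r.1) -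
        h (f (t' + Real.sqrt ε * r.1) r.2.1 + Real.sqrt Δ * r.2.2) (t' + b * r.1)‖ ≤
      C * (K + 1) * E * |t - t'| * (1 + t ^ 2 + t' ^ 2) * (1 + r.1 ^ 2 + r.2.2 ^ 2) := by
    intro r
    rw [Real.norm_eq_abs]
    refine (hh _ _ _ _).trans ?_
    have b1 : |f (t + Real.sqrt ε * r.1) r.2.1 + Real.sqrt Δ * r.2.2 -
        (f (t' + Real.sqrt ε * r.1) r.2.1 + Real.sqrt Δ * r.2.2)| +
        |t + b * r.1 - (t' + b * r.1)| ≤ (K + 1) * |t - t'| := by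
      have h1 := hK r.2.1 (t + Real.sqrt ε * r.1) (t' + Real.sqrt ε * r.1)
      rw [add_sub_add_right_eq_sub] at h1
      rw [add_sub_add_right_eq_sub, add_sub_add_right_eq_sub]
      linarith
    have b2 : ∀ t : ℝ, (t + b * r.1) ^ 2 ≤ 2 * t ^ 2 + 2 * b ^ 2 * r.1 ^ 2 := fun t => by
      nlinarith [sq_nonneg (t - b * r.1)]
    have b3 : 1 + (f (t + Real.sqrt ε * r.1) r.2.1 + Real.sqrt Δ * r.2.2) ^ 2 +
        (f (t' + Real.sqrt ε * r.1) r.2.1 + Real.sqrt Δ * r.2.2) ^ 2 + (t + b * r.1) ^ 2 +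
        (t' + b * r.1) ^ 2 ≤ E * ((1 + t ^ 2 + t' ^ 2) * (1 + r.1 ^ 2 + r.2.2 ^ 2)) := by
      have c1 := hsq t r
      have c2 := hsq t' r
      have c3 := b2 t
      have c4 := b2 t'
      have d1 : 0 ≤ K ^ 2 * ε := by positivity
      have d2 : (1 + 3 * K ^ 2 + 2) * (t ^ 2 + t' ^ 2) +
          (6 * K ^ 2 * ε + 4 * b ^ 2 + 6 * Δ) * (r.1 ^ 2 + r.2.2 ^ 2) + 1 ≤
          E * ((1 + t ^ 2 + t' ^ 2) * (1 + r.1 ^ 2 + r.2.2 ^ 2)) := by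
        have f1 : 0 ≤ (t ^ 2 + t' ^ 2) * (r.1 ^ 2 + r.2.2 ^ 2) := by positivity
        have f2 : 0 ≤ 6 * K ^ 2 * ε + 4 * b ^ 2 + 6 * Δ := by positivity
        have f3 : 0 ≤ (6 * K ^ 2 * ε + 4 * b ^ 2 + 6 * Δ) * (t ^ 2 + t' ^ 2) := by positivity
        have f4 : 0 ≤ (3 + 3 * K ^ 2) * (r.1 ^ 2 + r.2.2 ^ 2) := by positivity
        have f5 := mul_nonneg hE0 f1
        have f6 : 0 ≤ 2 + 3 * K ^ 2 := by positivity
        nlinarith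
      have d3 : 0 ≤ K ^ 2 * ε * r.2.2 ^ 2 := by positivity
      have d4 : 0 ≤ Δ * r.1 ^ 2 := by positivity
      have d5 : 0 ≤ b ^ 2 * r.2.2 ^ 2 := by positivity
      nlinarith [sq_nonneg t, sq_nonneg t']
    calc _ ≤ C * ((K + 1) * |t - t'|) *
          (E * ((1 + t ^ 2 + t' ^ 2) * (1 + r.1 ^ 2 + r.2.2 ^ 2))) := by gcongr
      _ = _ := by ring
  rw [hsub, ← Real.norm_eq_abs]
  refine (norm_integral_le_of_norm_le (hM.const_mul _) (.of_forall hpt)).trans (le_of_eq ?_)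
  rw [integral_const_mul]
  ring

lemma measurable_Pout {p : ℕ} (PA : Measure (Fin p → ℝ)) [IsProbabilityMeasure PA] (Δ : ℝ)
    {f : ℝ → (Fin p → ℝ) → ℝ} (hf : Measurable (Function.uncurry f)) (y : ℝ) :
    Measurable (Pout PA Δ f y) := by
  have h : Measurable fun q : ℝ × (Fin p → ℝ) => f q.1 q.2 := hf
  have : StronglyMeasurable fun q : ℝ × (Fin p → ℝ) =>
      Real.exp (-(y - f q.1 q.2) ^ 2 / (2 * Δ)) / Real.sqrt (2 * Real.pi * Δ) :=
    (by fun_prop : Measurable _).stronglyMeasurable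
  exact this.integral_prod_right'.measurable

lemma integral_comp_mul_sqrt_add {k : ℝ → ℝ} (hk : Measurable k) {u ε : ℝ} (hu : 0 ≤ u)
    (hε : 0 ≤ ε) : ∫ z, k (z * Real.sqrt (u + ε)) ∂stdG =
      ∫ g : ℝ × ℝ, k (g.1 * Real.sqrt u + Real.sqrt ε * g.2) ∂(stdG.prod stdG) := by
  rw [← integral_map (φ := fun z => z * Real.sqrt (u + ε)) (f := k) (by fun_prop)
    hk.aestronglyMeasurable, ← map_add_stdG_prod u ε hu hε,
    integral_map (by fun_prop) hk.aestronglyMeasurable]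

lemma measurePreserving_netOut {φ : ℝ → ℝ} (hφ : Measurable φ) (d : ℕ → ℕ) (L p : ℕ)
    (PA : Measure (Fin p → ℝ)) [IsProbabilityMeasure PA] :
    MeasurePreserving (fun ω : oneSpace d L p => (netOut φ d L ω.2.1 ω.2.2.1 ω.1, ω.2.2.2))
      (oneMeasure d L p PA) ((netLaw φ d L).prod (stdG.prod (PA.prod stdG))) := by
  have hn : MeasurePreserving (fun q : ((Fin (d 0) → ℝ) × Wspace d L) × (Fin (d L) → ℝ) =>
      netOut φ d L q.1.2 q.2 q.1.1)
      (((stdGPi (d 0)).prod (Wmeasure d L)).prod (stdGPi (d L))) (netLaw φ d L) :=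
    ⟨measurable_netOut hφ d L, rfl⟩
  have := isProbabilityMeasure_netLaw hφ d L
  have h1 := (measurePreserving_prodAssoc (stdGPi (d 0)) (Wmeasure d L)
    ((stdGPi (d L)).prod (stdG.prod (PA.prod stdG)))).symm
  have h2 := (measurePreserving_prodAssoc ((stdGPi (d 0)).prod (Wmeasure d L)) (stdGPi (d L))
    (stdG.prod (PA.prod stdG))).symm
  exact (hn.prod (MeasurePreserving.id _)).comp (h2.comp h1)

lemma integral_oneMeasure_eq {φ : ℝ → ℝ} (hφ : Measurable φ) (d : ℕ → ℕ) (L p : ℕ)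
    (PA : Measure (Fin p → ℝ)) [IsProbabilityMeasure PA] {K C : ℝ} (Δ ρ ε b : ℝ)
    {f : ℝ → (Fin p → ℝ) → ℝ} (hf : Measurable (Function.uncurry f))
    (hK : ∀ A x y, |f x A - f y A| ≤ K * |x - y|) (hf0 : ∀ A, f 0 A = 0) {h : ℝ → ℝ → ℝ}
    (hh : QuadLip₂ h C) (h4 : Integrable (fun t : ℝ => t ^ 4) (netLaw φ d L)) :
    ∫ ω, h (oneY φ f d L ρ ε Δ ω) (ρ * netOut φ d L ω.2.1 ω.2.2.1 ω.1 + b * ω.2.2.2.1)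
      ∂(oneMeasure d L p PA) = ∫ t, chanAvg PA Δ ε b f h (ρ * t) ∂(netLaw φ d L) := by
  have := isProbabilityMeasure_netLaw hφ d L
  have hid : MemLp (fun t : ℝ => t) 4 (netLaw φ d L) := by
    refine (integrable_norm_rpow_iff (by fun_prop) (by norm_num) (by simp)).1 ?_
    refine h4.congr (.of_forall fun t => ?_)
    simp only [Real.norm_eq_abs]
    norm_num
    exact ((by decide : Even 4).pow_abs t).symm
  have hi := integrable_chanAvg PA Δ ε b hf hK hf0 hh (X := fun t => ρ * t) (by fun_prop)
    (hid.const_mul ρ)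
  have hmp := measurePreserving_netOut hφ d L p PA
  unfold chanAvg
  refine Eq.trans ?_ (integral_prod _ hi)
  rw [← hmp.map_eq, integral_map hmp.measurable.aemeasurable]
  · rfl
  · rw [hmp.map_eq]
    exact hi.aestronglyMeasurable

lemma integral_integral_eq_chanAvg {p : ℕ} (PA : Measure (Fin p → ℝ)) [IsProbabilityMeasure PA]
    {K C : ℝ} (Δ ε b c : ℝ) {f : ℝ → (Fin p → ℝ) → ℝ} (hf : Measurable (Function.uncurry f))
    (hK : ∀ A x y, |f x A - f y A| ≤ K * |x - y|) (hf0 : ∀ A, f 0 A = 0) {h : ℝ → ℝ → ℝ}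
    (hh : QuadLip₂ h C) :
    ∫ g : ℝ × ℝ, ∫ r, h (f (g.1 * c + Real.sqrt ε * g.2) r.1 + Real.sqrt Δ * r.2)
      (g.1 * c + b * g.2) ∂(PA.prod stdG) ∂(stdG.prod stdG) =
      ∫ z, chanAvg PA Δ ε b f h (z * c) ∂stdG := by
  have hi := integrable_chanAvg PA Δ ε b hf hK hf0 hh (μ := stdG) (X := fun t => t * c)
    (by fun_prop) ((memLp_id_stdG 4 (by simp)).mul_const c)
  have hmp := measurePreserving_prodAssoc stdG stdG (PA.prod stdG)
  have hi' := (hmp.integrable_comp_emb (MeasurableEquiv.measurableEmbedding _)).2 hi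
  unfold chanAvg
  refine Eq.trans ?_ (integral_prod _ hi)
  rw [← hmp.integral_comp']
  exact (integral_prod _ hi').symm

lemma abs_sub_le_of_abs_deriv_le {g : ℝ → ℝ} {K : ℝ} (hg : Differentiable ℝ g)
    (hK : ∀ x, |deriv g x| ≤ K) (x y : ℝ) : |g x - g y| ≤ K * |x - y| :=
  Convex.norm_image_sub_le_of_norm_deriv_le (fun z _ => hg z) (fun z _ => hK z) convex_univ
    (Set.mem_univ y) (Set.mem_univ x)

/-- **Lemma (relation between mutual informations).** Up to `O(d_m^{−1/2})`,
`I_n(ξ*; D | θ*)` equals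
`−∫ dy E_{Z,ξ*}[P_out(y|Z√(ρ²σ_L)+√εξ*) log E_ξ P_out(y|Z√(ρ²σ_L)+√εξ)]
 + ∫ dy E_Z[P_out(y|Z√(ρ²σ_L+ε)) log P_out(y|Z√(ρ²σ_L+ε))]`. -/
theorem conditional_mutual_information_asymptotics
    (L p : ℕ) (hL : 1 ≤ L)
    (PA : Measure (Fin p → ℝ)) [IsProbabilityMeasure PA]
    (Δ ρ ε : ℝ) (hΔ : 0 < Δ) (hρ : 0 < ρ) (hε : 0 ≤ ε)
    (φ : ℝ → ℝ) (f : ℝ → (Fin p → ℝ) → ℝ)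
    (hφC2 : ContDiff ℝ 2 φ) (hφodd : ∀ x, φ (-x) = -φ x)
    (hφbd : ∃ K, ∀ x, |deriv φ x| ≤ K ∧ |deriv (deriv φ) x| ≤ K)
    (hfC2 : ∀ A, ContDiff ℝ 2 (fun x => f x A))
    (hfodd : ∀ x A, f (-x) A = -f x A)
    (hfbd : ∃ K, ∀ x A, |deriv (fun x' => f x' A) x| ≤ K ∧
      |deriv (deriv (fun x' => f x' A)) x| ≤ K)
    (hfmeas : Measurable (Function.uncurry f)) :
    ∃ C > 0, ∀ d : ℕ → ℕ, (∀ ℓ ≤ L, 1 ≤ d ℓ) →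
      |condMI L p PA Δ ρ ε φ f d -
        (-(∫ y : ℝ, ∫ g : ℝ × ℝ,
              Pout PA Δ f y (g.1 * Real.sqrt (ρ ^ 2 * sigmaC φ L) + Real.sqrt ε * g.2) *
                Real.log (PoutEps PA Δ f ε y (g.1 * Real.sqrt (ρ ^ 2 * sigmaC φ L)))
              ∂(stdG.prod stdG)) +
          ∫ y : ℝ, ∫ z : ℝ,
              Pout PA Δ f y (z * Real.sqrt (ρ ^ 2 * sigmaC φ L + ε)) *
                Real.log (Pout PA Δ f y (z * Real.sqrt (ρ ^ 2 * sigmaC φ L + ε)))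
              ∂stdG)| ≤
      C / Real.sqrt (dmin d L : ℝ) := by
  have hφ0 : φ 0 = 0 := by
    have := hφodd 0
    rw [neg_zero] at this
    linarith
  have hf0 : ∀ A, f 0 A = 0 := fun A => by
    have := hfodd 0 A
    rw [neg_zero] at this
    linarith
  obtain ⟨Kφ, hKφ⟩ := hφbd
  obtain ⟨K, hK⟩ := hfbd
  have hφL := abs_sub_le_of_abs_deriv_le (hφC2.differentiable (by norm_num)) fun x => (hKφ x).1
  have hfL : ∀ A x y, |f x A - f y A| ≤ K * |x - y| := fun A =>
    abs_sub_le_of_abs_deriv_le ((hfC2 A).differentiable (by norm_num)) fun x => (hK x A).1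
  have hφm := hφC2.continuous.measurable
  obtain ⟨C₁, h₁⟩ := exists_quadLip₂_log_PoutEps PA hΔ hε hfmeas hfL hf0
  obtain ⟨C₂, h₂⟩ := exists_quadLip₂_log_PoutEps PA hΔ le_rfl hfmeas hfL hf0
  simp only [PoutEps_zero] at h₂
  obtain ⟨B₁, hB₁⟩ := exists_quadLip_chanAvg PA 0 hΔ hε hfmeas hfL hf0 h₁
  obtain ⟨B₂, hB₂⟩ := exists_quadLip_chanAvg PA (Real.sqrt ε) hΔ hε hfmeas hfL hf0 h₂
  obtain ⟨C, hC, happrox⟩ := exists_netLaw_approx hφC2.continuous hφL hφ0 L ρ hρ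
  set V := ρ ^ 2 * sigmaC φ L with hV
  have hV0 : 0 ≤ V := mul_nonneg (sq_nonneg ρ) (sigmaC_nonneg φ L)
  have hid : MemLp (fun z : ℝ => z) 4 stdG := memLp_id_stdG 4 (by simp)
  have hfst : ∀ c : ℝ, MemLp (fun g : ℝ × ℝ => g.1 * c) 4 (stdG.prod stdG) := fun c =>
    (hid.comp_fst stdG).mul_const c
  have hsnd : ∀ c : ℝ, MemLp (fun g : ℝ × ℝ => c * g.2) 4 (stdG.prod stdG) := fun c =>
    (hid.comp_snd stdG).const_mul c
  have hT₁ := (integral_Pout_mul PA hΔ hfmeas hfL hf0 h₁ (stdG.prod stdG)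
    (x := fun g => g.1 * Real.sqrt V + Real.sqrt ε * g.2) (s := fun g => g.1 * Real.sqrt V)
    (by fun_prop) (by fun_prop) ((hfst _).add (hsnd _)) (hfst _)).trans
    (by simpa using integral_integral_eq_chanAvg PA Δ ε 0 (Real.sqrt V) hfmeas hfL hf0 h₁)
  have hT₂ : (∫ y : ℝ, ∫ z : ℝ, Pout PA Δ f y (z * Real.sqrt (V + ε)) *
      Real.log (Pout PA Δ f y (z * Real.sqrt (V + ε))) ∂stdG) = ∫ z, chanAvg PA Δ ε
        (Real.sqrt ε) f (fun y s => Real.log (Pout PA Δ f y s)) (z * Real.sqrt V) ∂stdG := by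
    rw [← integral_integral_eq_chanAvg PA Δ ε (Real.sqrt ε) (Real.sqrt V) hfmeas hfL hf0 h₂,
      ← integral_Pout_mul PA hΔ hfmeas hfL hf0 h₂ (stdG.prod stdG)
        (x := fun g => g.1 * Real.sqrt V + Real.sqrt ε * g.2)
        (s := fun g => g.1 * Real.sqrt V + Real.sqrt ε * g.2)
        (by fun_prop) (by fun_prop) ((hfst _).add (hsnd _)) ((hfst _).add (hsnd _))]
    refine integral_congr_ae (.of_forall fun y => ?_)
    have hm := measurable_Pout PA Δ hfmeas y
    exact integral_comp_mul_sqrt_add (hm.mul hm.log) hV0 hε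
  refine ⟨(B₁ + B₂) * C + 1, ?_, fun d hd => ?_⟩
  · have := mul_nonneg (add_nonneg hB₁.nonneg hB₂.nonneg) hC
    linarith
  obtain ⟨h4, happ⟩ := happrox d hd
  have e₁ := integral_oneMeasure_eq hφm d L p PA Δ ρ ε 0 hfmeas hfL hf0 h₁ h4
  have e₂ := integral_oneMeasure_eq hφm d L p PA Δ ρ ε (Real.sqrt ε) hfmeas hfL hf0 h₂ h4
  have a₁ := happ _ _ hB₁
  have a₂ := happ _ _ hB₂
  simp only [zero_mul, add_zero] at e₁
  rw [hT₁, hT₂, condMI, e₁]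
  simp only [oneSig]
  rw [e₂]
  rw [abs_le] at a₁ a₂ ⊢
  have hD : 0 ≤ 1 / Real.sqrt (dmin d L : ℝ) := by positivity
  have hs : ((B₁ + B₂) * C + 1) / Real.sqrt (dmin d L : ℝ) =
      B₁ * (C / Real.sqrt (dmin d L : ℝ)) + B₂ * (C / Real.sqrt (dmin d L : ℝ)) +
        1 / Real.sqrt (dmin d L : ℝ) := by ring
  rw [hs]
  constructor <;> linarith [a₁.1, a₁.2, a₂.1, a₂.2]

end
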